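/- Suppose μ₂ > 0 and λ₂ = μ₂. Then for every j ∈ ℕ the limit p_j := lim_{t→∞} P(d(V_t) = j) exists; moreover p_0 = U(1, 0, λ₁/λ₂) and, for every j ≥ 1, p_j = (λ₁/λ₂)·Γ(j)·U(j, 0, λ₁/λ₂). -/

import Mathlib

open Filter Topology MeasureTheory

/-- The Beta function `B(a,b) = ∫₀¹ s^(a-1) (1-s)^(b-1) ds`. -/
noncomputable def betaFn (a b : ℝ) : ℝ :=
  ∫ s in (0:ℝ)..1, s ^ (a - 1) * (1 - s) ^ (b - 1)

/-- The Gauss hypergeometric function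
`₂F₁(a,b,c,z) = (1/B(b,c-b)) ∫₀¹ s^(b-1) (1-s)^(c-b-1) (1-sz)^(-a) ds`. -/
noncomputable def gauss2F1 (a b c z : ℝ) : ℝ :=
  (betaFn b (c - b))⁻¹ * ∫ s in (0:ℝ)..1, s ^ (b - 1) * (1 - s) ^ (c - b - 1) * (1 - s * z) ^ (-a)

/-- The confluent hypergeometric function
`U(a,b,z) = (1/Γ(a)) ∫₀^∞ e^(-zs) s^(a-1) (1+s)^(b-a-1) ds`. -/
noncomputable def hypU (a b z : ℝ) : ℝ :=
  (Real.Gamma a)⁻¹ * ∫ s in Set.Ioi (0:ℝ), Real.exp (-z * s) * s ^ (a - 1) * (1 + s) ^ (b - a - 1)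

/-- One-step transition probability of the preferential attachment–detachment
in-degree chain on nonempty finite sequences of naturals (encoded as lists):
from a state `x`, the `i`-th entry is increased by `1` with probability
`xⁱλ₂ / ((λ₂+μ₂)‖x‖ + ℓ(x)λ₁)`, decreased by `1` with probability
`xⁱμ₂ / ((λ₂+μ₂)‖x‖ + ℓ(x)λ₁)`, and an entry `1` is appended with probability
`ℓ(x)λ₁ / ((λ₂+μ₂)‖x‖ + ℓ(x)λ₁)`. -/
noncomputable def stepProb (lam1 lam2 mu2 : ℝ) (x y : List ℕ) : ℝ :=
  ((∑ i ∈ Finset.range x.length,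
      (x.getD i 0 : ℝ) * lam2 * (if y = x.set i (x.getD i 0 + 1) then 1 else 0)) +
   (∑ i ∈ Finset.range x.length,
      (x.getD i 0 : ℝ) * mu2 * (if y = x.set i (x.getD i 0 - 1) then 1 else 0)) +
   (x.length : ℝ) * lam1 * (if y = x ++ [1] then 1 else 0)) /
    ((lam2 + mu2) * (x.sum : ℝ) + (x.length : ℝ) * lam1)

/-- Distribution at time `t` of the Markov chain `d = (d_t)` started at the
length-one sequence `(1)`. -/
noncomputable def chainDist (lam1 lam2 mu2 : ℝ) : ℕ → List ℕ → ℝ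
  | 0 => fun x => if x = [1] then 1 else 0
  | (t + 1) => fun y => ∑' x : List ℕ, chainDist lam1 lam2 mu2 t x * stepProb lam1 lam2 mu2 x y

/-- `P(d(V_t) = j)`, the in-degree distribution of a vertex chosen uniformly at
random at time `t`, i.e. the expectation of `ℓ(d_t)⁻¹ ∑ᵢ 1{d_tⁱ = j}`. -/
noncomputable def inDegProb (lam1 lam2 mu2 : ℝ) (t j : ℕ) : ℝ :=
  ∑' x : List ℕ, chainDist lam1 lam2 mu2 t x * ((x.count j : ℝ) / (x.length : ℝ))

/-- The one-step transition operator of the chain, acting on functions of the state. -/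
noncomputable def stepOp (lam1 lam2 mu2 : ℝ) : (List ℕ → ℝ) →ₗ[ℝ] (List ℕ → ℝ) where
  toFun F x :=
    ((∑ i ∈ Finset.range x.length, (x.getD i 0 : ℝ) * lam2 * F (x.set i (x.getD i 0 + 1))) +
      (∑ i ∈ Finset.range x.length, (x.getD i 0 : ℝ) * mu2 * F (x.set i (x.getD i 0 - 1))) +
      (x.length : ℝ) * lam1 * F (x ++ [1])) /
      ((lam2 + mu2) * (x.sum : ℝ) + (x.length : ℝ) * lam1)
  map_add' F G := by
    funext x
    simp only [Pi.add_apply, mul_add, Finset.sum_add_distrib, ← add_div]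
    congr 1
    ring
  map_smul' r F := by
    funext x
    simp only [Pi.smul_apply, smul_eq_mul, RingHom.id_apply, ← mul_div_assoc]
    congr 1
    rw [mul_add, mul_add, Finset.mul_sum, Finset.mul_sum]
    congr 1
    · congr 1 <;> exact Finset.sum_congr rfl fun i _ => by ring
    · ring

theorem stepOp_apply (lam1 lam2 mu2 : ℝ) (F : List ℕ → ℝ) (x : List ℕ) :
    stepOp lam1 lam2 mu2 F x =
    ((∑ i ∈ Finset.range x.length, (x.getD i 0 : ℝ) * lam2 * F (x.set i (x.getD i 0 + 1))) +
      (∑ i ∈ Finset.range x.length, (x.getD i 0 : ℝ) * mu2 * F (x.set i (x.getD i 0 - 1))) +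
      (x.length : ℝ) * lam1 * F (x ++ [1])) /
      ((lam2 + mu2) * (x.sum : ℝ) + (x.length : ℝ) * lam1) := rfl

/-- Expectation of a function of the state of the chain at time `t`. -/
noncomputable def chainExp (lam1 lam2 mu2 : ℝ) (t : ℕ) : (List ℕ → ℝ) →ₗ[ℝ] ℝ :=
  (LinearMap.proj [1]).comp (stepOp lam1 lam2 mu2 ^ t)

theorem chainExp_zero (lam1 lam2 mu2 : ℝ) (F : List ℕ → ℝ) :
    chainExp lam1 lam2 mu2 0 F = F [1] := rfl

theorem chainExp_succ (lam1 lam2 mu2 : ℝ) (t : ℕ) (F : List ℕ → ℝ) :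
    chainExp lam1 lam2 mu2 (t + 1) F = chainExp lam1 lam2 mu2 t (stepOp lam1 lam2 mu2 F) := by
  simp [chainExp, pow_succ]

/-- The states that can be reached from `x` in one step. -/
def succStates (x : List ℕ) : Finset (List ℕ) :=
  (Finset.range x.length).image (fun i => x.set i (x.getD i 0 + 1)) ∪
    (Finset.range x.length).image (fun i => x.set i (x.getD i 0 - 1)) ∪ {x ++ [1]}

theorem stepProb_eq_zero (lam1 lam2 mu2 : ℝ) {x y : List ℕ} (hy : y ∉ succStates x) :
    stepProb lam1 lam2 mu2 x y = 0 := by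
  simp only [succStates, Finset.mem_union, Finset.mem_image, Finset.mem_singleton, not_or,
    not_exists, not_and] at hy
  obtain ⟨⟨h1, h2⟩, h3⟩ := hy
  rw [stepProb, Finset.sum_eq_zero, Finset.sum_eq_zero, if_neg h3]
  · simp
  · intro i hi
    rw [if_neg fun h => h2 i hi h.symm, mul_zero]
  · intro i hi
    rw [if_neg fun h => h1 i hi h.symm, mul_zero]

theorem sum_stepProb_mul (lam1 lam2 mu2 : ℝ) (F : List ℕ → ℝ) {x : List ℕ}
    {B : Finset (List ℕ)} (hB : succStates x ⊆ B) :
    ∑ y ∈ B, stepProb lam1 lam2 mu2 x y * F y = stepOp lam1 lam2 mu2 F x := by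
  have key : ∀ (c : ℝ) (z : List ℕ), z ∈ B →
      ∑ y ∈ B, c * (if y = z then 1 else 0) * F y = c * F z := by
    intro c z hz
    rw [Finset.sum_eq_single_of_mem z hz]
    · simp
    · intro y _ hy
      simp [hy]
  simp only [stepProb, div_mul_eq_mul_div, ← Finset.sum_div]
  rw [stepOp_apply]
  congr 1
  simp only [add_mul _ _ (F _), Finset.sum_add_distrib, Finset.sum_mul _ _ (F _)]
  rw [Finset.sum_comm, Finset.sum_comm (s := B)]
  congr 1
  · congr 1
    · refine Finset.sum_congr rfl fun i hi => key _ _ (hB ?_)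
      simp only [succStates, Finset.mem_union, Finset.mem_image]
      exact Or.inl (Or.inl ⟨i, hi, rfl⟩)
    · refine Finset.sum_congr rfl fun i hi => key _ _ (hB ?_)
      simp only [succStates, Finset.mem_union, Finset.mem_image]
      exact Or.inl (Or.inr ⟨i, hi, rfl⟩)
  · exact key _ _ (hB (by simp [succStates]))

theorem chainDist_finite_support (lam1 lam2 mu2 : ℝ) (t : ℕ) :
    ∃ S : Finset (List ℕ), ∀ x ∉ S, chainDist lam1 lam2 mu2 t x = 0 := by
  induction t with
  | zero => exact ⟨{[1]}, fun x hx => by simpa [chainDist] using hx⟩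
  | succ t ih =>
    obtain ⟨S, hS⟩ := ih
    refine ⟨S.biUnion succStates, fun y hy => ?_⟩
    rw [chainDist]
    refine (tsum_congr fun x => ?_).trans tsum_zero
    by_cases hx : x ∈ S
    · rw [stepProb_eq_zero, mul_zero]
      exact fun h => hy (Finset.mem_biUnion.2 ⟨x, hx, h⟩)
    · rw [hS x hx, zero_mul]

theorem tsum_chainDist_mul (lam1 lam2 mu2 : ℝ) (t : ℕ) (F : List ℕ → ℝ) :
    ∑' x, chainDist lam1 lam2 mu2 t x * F x = chainExp lam1 lam2 mu2 t F := by
  induction t generalizing F with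
  | zero =>
    rw [chainExp_zero, tsum_eq_single [1]]
    · simp [chainDist]
    · intro x hx
      simp [chainDist, hx]
  | succ t ih =>
    obtain ⟨S, hS⟩ := chainDist_finite_support lam1 lam2 mu2 t
    have hd : ∀ y, chainDist lam1 lam2 mu2 (t + 1) y =
        ∑ x ∈ S, chainDist lam1 lam2 mu2 t x * stepProb lam1 lam2 mu2 x y := fun y =>
      tsum_eq_sum fun x hx => by rw [hS x hx, zero_mul]
    rw [chainExp_succ, ← ih, tsum_eq_sum (s := S.biUnion succStates) fun y hy => by
      rw [hd, Finset.sum_eq_zero, zero_mul]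
      intro x hx
      rw [stepProb_eq_zero, mul_zero]
      exact fun h => hy (Finset.mem_biUnion.2 ⟨x, hx, h⟩)]
    rw [tsum_eq_sum (s := S) fun x hx => by rw [hS x hx, zero_mul]]
    simp only [hd, Finset.sum_mul]
    rw [Finset.sum_comm]
    refine Finset.sum_congr rfl fun x hx => ?_
    rw [← sum_stepProb_mul lam1 lam2 mu2 F (Finset.subset_biUnion_of_mem succStates hx),
      Finset.mul_sum]
    exact Finset.sum_congr rfl fun y _ => by ring

theorem sum_range_getD {M : Type*} [AddCommMonoid M] (g : ℕ → M) (x : List ℕ) :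
    ∑ i ∈ Finset.range x.length, g (x.getD i 0) = (x.map g).sum := by
  induction x with
  | nil => simp
  | cons b x ih =>
    rw [List.length_cons, Finset.sum_range_succ', List.map_cons, List.sum_cons, add_comm]
    simp only [List.getD_cons_zero, List.getD_cons_succ, ih]

theorem sum_map_set_add {M : Type*} [AddCommMonoid M] (f : ℕ → M) (x : List ℕ) {i : ℕ}
    (hi : i < x.length) (v : ℕ) :
    ((x.set i v).map f).sum + f (x.getD i 0) = (x.map f).sum + f v := by
  induction x generalizing i with
  | nil => simp at hi
  | cons b x ih =>
    cases i with
    | zero =>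
      simp only [List.set_cons_zero, List.map_cons, List.sum_cons, List.getD_cons_zero]
      abel
    | succ i =>
      have := ih (i := i) (by simpa using hi)
      simp only [List.set_cons_succ, List.map_cons, List.sum_cons, List.getD_cons_succ]
      rw [add_assoc, this, add_assoc]

theorem sum_set_add (x : List ℕ) {i : ℕ} (hi : i < x.length) (v : ℕ) :
    (x.set i v).sum + x.getD i 0 = x.sum + v := by
  simpa using sum_map_set_add id x hi v

/-- A property of every state that the chain can occupy at time `t`. -/
def Reachable (t : ℕ) (x : List ℕ) : Prop :=
  1 ≤ x.length ∧ x.length ≤ t + 1 ∧ x.sum ≤ t + 1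

theorem stepOp_mono {lam1 lam2 mu2 : ℝ} (h1 : 0 ≤ lam1) (h2 : 0 ≤ lam2) (h3 : 0 ≤ mu2)
    {t : ℕ} {F G : List ℕ → ℝ} (hFG : ∀ x, Reachable (t + 1) x → F x ≤ G x)
    {x : List ℕ} (hx : Reachable t x) :
    stepOp lam1 lam2 mu2 F x ≤ stepOp lam1 lam2 mu2 G x := by
  obtain ⟨hx1, hx2, hx3⟩ := hx
  rw [stepOp_apply, stepOp_apply]
  refine div_le_div_of_nonneg_right ?_ (by positivity)
  refine add_le_add (add_le_add (Finset.sum_le_sum fun i hi => ?_)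
    (Finset.sum_le_sum fun i hi => ?_)) ?_
  · have := sum_set_add x (Finset.mem_range.1 hi) (x.getD i 0 + 1)
    refine mul_le_mul_of_nonneg_left (hFG _ ⟨?_, ?_, ?_⟩) (by positivity) <;>
      grind
  · have := sum_set_add x (Finset.mem_range.1 hi) (x.getD i 0 - 1)
    refine mul_le_mul_of_nonneg_left (hFG _ ⟨?_, ?_, ?_⟩) (by positivity) <;>
      grind
  · refine mul_le_mul_of_nonneg_left (hFG _ ⟨?_, ?_, ?_⟩) (by positivity) <;>
      simp <;> omega

theorem chainExp_mono {lam1 lam2 mu2 : ℝ} (h1 : 0 ≤ lam1) (h2 : 0 ≤ lam2) (h3 : 0 ≤ mu2)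
    {t : ℕ} {F G : List ℕ → ℝ} (hFG : ∀ x, Reachable t x → F x ≤ G x) :
    chainExp lam1 lam2 mu2 t F ≤ chainExp lam1 lam2 mu2 t G := by
  induction t generalizing F G with
  | zero => exact hFG _ ⟨by simp, by simp, by simp⟩
  | succ t ih =>
    rw [chainExp_succ, chainExp_succ]
    exact ih fun x hx => stepOp_mono h1 h2 h3 hFG hx

theorem chainExp_congr {lam1 lam2 mu2 : ℝ} (h1 : 0 ≤ lam1) (h2 : 0 ≤ lam2) (h3 : 0 ≤ mu2)
    {t : ℕ} {F G : List ℕ → ℝ} (hFG : ∀ x, Reachable t x → F x = G x) :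
    chainExp lam1 lam2 mu2 t F = chainExp lam1 lam2 mu2 t G :=
  le_antisymm (chainExp_mono h1 h2 h3 fun x hx => (hFG x hx).le)
    (chainExp_mono h1 h2 h3 fun x hx => (hFG x hx).ge)

/-- The total transition rate out of the state `x` in the critical regime. -/
noncomputable def totalRate (a l : ℝ) (x : List ℕ) : ℝ :=
  (l + l) * (x.sum : ℝ) + (x.length : ℝ) * a

theorem totalRate_pos {a l : ℝ} (ha : 0 < a) (hl : 0 < l) {x : List ℕ} (hx : 1 ≤ x.length) :
    0 < totalRate a l x := by
  have : (1 : ℝ) ≤ x.length := by exact_mod_cast hx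
  unfold totalRate
  positivity

theorem stepOp_length_sum (a l : ℝ) (φ : ℝ → ℝ → ℝ) (x : List ℕ) :
    stepOp a l l (fun x => φ x.length ((x.sum : ℝ) - x.length)) x =
      (l * x.sum * (φ x.length ((x.sum : ℝ) - x.length + 1) +
          φ x.length ((x.sum : ℝ) - x.length - 1)) +
        a * x.length * φ (x.length + 1) ((x.sum : ℝ) - x.length)) / totalRate a l x := by
  rw [stepOp_apply, totalRate]
  congr 1
  have hM : ∑ i ∈ Finset.range x.length, (x.getD i 0 : ℝ) = x.sum := by
    rw [sum_range_getD (fun k => (k : ℝ)) x, Nat.cast_list_sum]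
  rw [mul_add]
  congr 1
  · congr 1
    · rw [← hM, Finset.mul_sum, Finset.sum_mul, hM]
      refine Finset.sum_congr rfl fun i hi => ?_
      have := sum_set_add x (Finset.mem_range.1 hi) (x.getD i 0 + 1)
      have h : (x.set i (x.getD i 0 + 1)).sum = x.sum + 1 := by omega
      rw [h, List.length_set, Nat.cast_add, Nat.cast_one, add_sub_right_comm]
      ring
    · rw [← hM, Finset.mul_sum, Finset.sum_mul, hM]
      refine Finset.sum_congr rfl fun i hi => ?_
      have := sum_set_add x (Finset.mem_range.1 hi) (x.getD i 0 - 1)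
      rcases Nat.eq_zero_or_pos (x.getD i 0) with h0 | h0
      · rw [h0]
        simp
      · have h : (x.set i (x.getD i 0 - 1)).sum + 1 = x.sum := by omega
        rw [List.length_set, ← h, Nat.cast_add, Nat.cast_one, add_sub_right_comm, add_sub_cancel_right]
        ring
  · simp only [List.length_append, List.length_singleton, List.sum_append, List.sum_singleton,
      Nat.cast_add, Nat.cast_one, add_sub_add_right_eq_sub]
    ring

theorem stepOp_sum_map {a l : ℝ} (ha : 0 < a) (hl : 0 < l) (f : ℕ → ℝ) {x : List ℕ}
    (hx : 1 ≤ x.length) :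
    stepOp a l l (fun x => (x.map f).sum) x = (x.map f).sum +
      (l * (x.map fun k : ℕ => (k : ℝ) * (f (k + 1) - 2 * f k + f (k - 1))).sum +
        a * x.length * f 1) / totalRate a l x := by
  have hD := (totalRate_pos ha hl hx).ne'
  have hM : (x.sum : ℝ) = ∑ i ∈ Finset.range x.length, (x.getD i 0 : ℝ) := by
    rw [sum_range_getD (fun k => (k : ℝ)) x, Nat.cast_list_sum]
  have hset : ∀ i ∈ Finset.range x.length, ∀ v,
      ((x.set i v).map f).sum = (x.map f).sum + f v - f (x.getD i 0) := fun i hi v =>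
    eq_sub_of_add_eq (sum_map_set_add f x (Finset.mem_range.1 hi) v)
  rw [stepOp_apply, ← totalRate, div_eq_iff hD, add_mul, div_mul_cancel₀ _ hD, totalRate, mul_add,
    ← sum_range_getD (fun k : ℕ => (k : ℝ) * (f (k + 1) - 2 * f k + f (k - 1))) x, hM,
    Finset.mul_sum, Finset.mul_sum, Finset.mul_sum, List.map_append, List.sum_append,
    List.map_singleton, List.sum_singleton, ← Finset.sum_add_distrib]
  have : ∑ i ∈ Finset.range x.length,
      ((x.getD i 0 : ℝ) * l * ((x.set i (x.getD i 0 + 1)).map f).sum +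
        (x.getD i 0 : ℝ) * l * ((x.set i (x.getD i 0 - 1)).map f).sum) =
      ∑ i ∈ Finset.range x.length, (x.map f).sum * ((l + l) * (x.getD i 0 : ℝ)) +
      ∑ i ∈ Finset.range x.length, l * ((x.getD i 0 : ℝ) *
        (f (x.getD i 0 + 1) - 2 * f (x.getD i 0) + f (x.getD i 0 - 1))) := by
    rw [← Finset.sum_add_distrib]
    refine Finset.sum_congr rfl fun i hi => ?_
    rw [hset i hi, hset i hi]
    ring
  rw [this]
  ring

theorem stepOp_const {a l : ℝ} (ha : 0 < a) (hl : 0 < l) (c : ℝ) {x : List ℕ}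
    (hx : 1 ≤ x.length) : stepOp a l l (fun _ => c) x = c := by
  have hD := (totalRate_pos ha hl hx).ne'
  rw [stepOp_length_sum a l (fun _ _ => c), div_eq_iff hD, totalRate]
  ring

theorem chainExp_const {a l : ℝ} (ha : 0 < a) (hl : 0 < l) (t : ℕ) (c : ℝ) :
    chainExp a l l t (fun _ => c) = c := by
  induction t with
  | zero => rfl
  | succ t ih =>
    rw [chainExp_succ]
    exact (chainExp_congr ha.le hl.le hl.le fun x hx => stepOp_const ha hl c hx.1).trans ih

theorem chainExp_add (lam1 lam2 mu2 : ℝ) (t : ℕ) (F G : List ℕ → ℝ) :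
    chainExp lam1 lam2 mu2 t (fun x => F x + G x) =
      chainExp lam1 lam2 mu2 t F + chainExp lam1 lam2 mu2 t G :=
  map_add _ F G

theorem chainExp_sub (lam1 lam2 mu2 : ℝ) (t : ℕ) (F G : List ℕ → ℝ) :
    chainExp lam1 lam2 mu2 t (fun x => F x - G x) =
      chainExp lam1 lam2 mu2 t F - chainExp lam1 lam2 mu2 t G :=
  map_sub _ F G

theorem chainExp_const_mul (lam1 lam2 mu2 : ℝ) (t : ℕ) (r : ℝ) (F : List ℕ → ℝ) :
    chainExp lam1 lam2 mu2 t (fun x => r * F x) = r * chainExp lam1 lam2 mu2 t F :=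
  map_smul _ r F

theorem chainExp_nonneg {a l : ℝ} (ha : 0 < a) (hl : 0 < l) {t : ℕ} {F : List ℕ → ℝ}
    (hF : ∀ x, Reachable t x → 0 ≤ F x) : 0 ≤ chainExp a l l t F :=
  (chainExp_const ha hl t 0).ge.trans (chainExp_mono ha.le hl.le hl.le hF)

theorem abs_chainExp_le {a l : ℝ} (ha : 0 < a) (hl : 0 < l) (t : ℕ) (F : List ℕ → ℝ) :
    |chainExp a l l t F| ≤ chainExp a l l t fun x => |F x| := by
  refine abs_le'.2 ⟨chainExp_mono ha.le hl.le hl.le fun x _ => le_abs_self _, ?_⟩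
  rw [neg_eq_neg_one_mul, ← chainExp_const_mul]
  exact chainExp_mono ha.le hl.le hl.le fun x _ => by simpa using neg_le_abs (F x)

theorem sq_chainExp_le {a l : ℝ} (ha : 0 < a) (hl : 0 < l) (t : ℕ) (F : List ℕ → ℝ) :
    chainExp a l l t F ^ 2 ≤ chainExp a l l t fun x => F x ^ 2 := by
  set m := chainExp a l l t F with hm
  have h : 0 ≤ chainExp a l l t fun x => F x ^ 2 - (2 * m * F x - m ^ 2) :=
    chainExp_nonneg ha hl fun x _ => by nlinarith [sq_nonneg (F x - m)]
  rw [chainExp_sub, chainExp_sub, chainExp_const_mul, chainExp_const ha hl, ← hm] at h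
  linarith

/-- The total in-degree minus the number of vertices; along the critical chain it is a
martingale. -/
def excess (x : List ℕ) : ℝ := (x.sum : ℝ) - x.length

theorem totalRate_eq (a l : ℝ) (x : List ℕ) :
    totalRate a l x = (2 * l + a) * x.length + 2 * l * excess x := by
  unfold totalRate excess
  ring

theorem mul_length_le_totalRate {a l : ℝ} (hl : 0 < l) (x : List ℕ) :
    a * x.length ≤ totalRate a l x := by
  have : 0 ≤ (l + l) * (x.sum : ℝ) := by positivity
  unfold totalRate
  linarith

theorem Reachable.totalRate_le {a l : ℝ} (ha : 0 < a) (hl : 0 < l) {t : ℕ} {x : List ℕ}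
    (hx : Reachable t x) : totalRate a l x ≤ (2 * l + a) * (t + 1) := by
  have h1 : (x.length : ℝ) ≤ t + 1 := by exact_mod_cast hx.2.1
  have h2 : (x.sum : ℝ) ≤ t + 1 := by exact_mod_cast hx.2.2
  unfold totalRate
  nlinarith

theorem Reachable.one_le_length {t : ℕ} {x : List ℕ} (hx : Reachable t x) :
    (1 : ℝ) ≤ x.length := by
  exact_mod_cast hx.1

theorem chainExp_excess_sq_le {a l : ℝ} (ha : 0 < a) (hl : 0 < l) (t : ℕ) :
    chainExp a l l t (fun x => excess x ^ 2) ≤ t := by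
  induction t with
  | zero => simp [chainExp_zero, excess]
  | succ t ih =>
    rw [chainExp_succ]
    refine (chainExp_mono (G := fun x => excess x ^ 2 + 1) ha.le hl.le hl.le
      fun x hx => ?_).trans ?_
    · have hD := totalRate_pos ha hl hx.1
      have hN := hx.one_le_length
      refine (stepOp_length_sum a l (fun _ y => y ^ 2) x).trans_le ?_
      rw [div_le_iff₀ hD, ← excess]
      unfold totalRate
      have : 0 ≤ (x.length : ℝ) * a := by positivity
      nlinarith
    · rw [chainExp_add, chainExp_const ha hl]
      push_cast
      linarith

theorem tendsto_zero_of_le_one_sub_mul {e : ℕ → ℝ} {κ : ℝ} (hκ : 0 < κ) (he : ∀ t, 0 ≤ e t)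
    (h : ∀ t : ℕ, e (t + 1) ≤ (1 - κ / (t + 1)) * e t) : Tendsto e atTop (𝓝 0) := by
  have key : ∀ t : ℕ, e t ≤ e 0 * Real.exp (-(κ * ∑ s ∈ Finset.range t, 1 / ((s : ℝ) + 1))) := by
    intro t
    induction t with
    | zero => simp
    | succ t ih =>
      have h1 : 1 - κ / (t + 1) ≤ Real.exp (-(κ / (t + 1))) := by
        have := Real.add_one_le_exp (-(κ / ((t : ℝ) + 1)))
        linarith
      calc e (t + 1) ≤ (1 - κ / (t + 1)) * e t := h t
        _ ≤ Real.exp (-(κ / (t + 1))) * e t := mul_le_mul_of_nonneg_right h1 (he t)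
        _ ≤ Real.exp (-(κ / (t + 1))) *
            (e 0 * Real.exp (-(κ * ∑ s ∈ Finset.range t, 1 / ((s : ℝ) + 1)))) :=
          mul_le_mul_of_nonneg_left ih (Real.exp_pos _).le
        _ = _ := by
          rw [Finset.sum_range_succ, mul_left_comm, ← Real.exp_add]
          congr 2
          ring
  refine squeeze_zero he key ?_
  rw [← mul_zero (e 0)]
  exact (Real.tendsto_exp_neg_atTop_nhds_zero.comp
    (Real.tendsto_sum_range_one_div_nat_succ_atTop.const_mul_atTop hκ)).const_mul _

theorem tendsto_chainExp_inv_length {a l : ℝ} (ha : 0 < a) (hl : 0 < l) :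
    Tendsto (fun t => chainExp a l l t fun x => (x.length : ℝ)⁻¹) atTop (𝓝 0) := by
  have hc : 0 < 2 * l + a := by positivity
  refine tendsto_zero_of_le_one_sub_mul (κ := a / (2 * (2 * l + a))) (by positivity)
    (fun t => chainExp_nonneg ha hl fun x _ => by positivity) fun t => ?_
  rw [chainExp_succ, ← chainExp_const_mul]
  refine chainExp_mono ha.le hl.le hl.le fun x hx => ?_
  have hD := totalRate_pos ha hl hx.1
  have hN := hx.one_le_length
  have hDle := hx.totalRate_le ha hl
  refine (stepOp_length_sum a l (fun n _ => n⁻¹) x).trans_le ?_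
  have h1 : (l * x.sum * ((x.length : ℝ)⁻¹ + (x.length : ℝ)⁻¹) +
      a * x.length * ((x.length : ℝ) + 1)⁻¹) / totalRate a l x =
      (x.length : ℝ)⁻¹ - a / (((x.length : ℝ) + 1) * totalRate a l x) := by
    rw [div_eq_iff hD.ne', sub_mul, div_mul_eq_mul_div, mul_div_mul_right _ _ hD.ne']
    unfold totalRate
    field_simp
    ring
  rw [h1, sub_mul, one_mul]
  refine sub_le_sub_left ?_ _
  rw [div_div, div_mul_eq_mul_div, ← div_eq_mul_inv, div_div]
  refine div_le_div_of_nonneg_left ha.le (by positivity) ?_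
  have : ((x.length : ℝ) + 1) * totalRate a l x ≤
      (2 * x.length) * ((2 * l + a) * (t + 1)) := by
    gcongr
    linarith
  linarith

theorem sum_chainExp_excess_div_sq_le {a l : ℝ} (ha : 0 < a) (hl : 0 < l) (t : ℕ) :
    a ^ 2 / 2 * ∑ s ∈ Finset.range t, chainExp a l l s (fun x => (excess x / totalRate a l x) ^ 2)
      ≤ ∑ s ∈ Finset.range t, chainExp a l l s fun x => (x.length : ℝ)⁻¹ := by
  suffices h : chainExp a l l t (fun x => excess x ^ 2 / x.length) + a ^ 2 / 2 *
      ∑ s ∈ Finset.range t, chainExp a l l s (fun x => (excess x / totalRate a l x) ^ 2)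
      ≤ ∑ s ∈ Finset.range t, chainExp a l l s fun x => (x.length : ℝ)⁻¹ by
    have : 0 ≤ chainExp a l l t (fun x => excess x ^ 2 / x.length) :=
      chainExp_nonneg ha hl fun x _ => by positivity
    linarith
  induction t with
  | zero => simp [chainExp_zero, excess]
  | succ t ih =>
    rw [chainExp_succ, Finset.sum_range_succ, Finset.sum_range_succ]
    have key : chainExp a l l t (stepOp a l l fun x => excess x ^ 2 / x.length) ≤
        chainExp a l l t (fun x => excess x ^ 2 / x.length +
          ((x.length : ℝ)⁻¹ - a ^ 2 / 2 * (excess x / totalRate a l x) ^ 2)) := by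
      refine chainExp_mono ha.le hl.le hl.le fun x hx => ?_
      have hD := totalRate_pos ha hl hx.1
      have hN := hx.one_le_length
      have hN0 : 0 < (x.length : ℝ) := by linarith
      refine (stepOp_length_sum a l (fun n y => y ^ 2 / n) x).trans_le ?_
      rw [← excess]
      have h1 : (l * x.sum * ((excess x + 1) ^ 2 / x.length + (excess x - 1) ^ 2 / x.length) +
          a * x.length * (excess x ^ 2 / (x.length + 1))) / totalRate a l x =
          excess x ^ 2 / x.length + ((l + l) * x.sum / (x.length * totalRate a l x) -
            a * excess x ^ 2 / ((x.length + 1) * totalRate a l x)) := by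
        generalize excess x = y
        rw [div_eq_iff hD.ne', add_mul, sub_mul, div_mul_eq_mul_div, div_mul_eq_mul_div,
          div_mul_eq_mul_div, mul_div_mul_right _ _ hD.ne', mul_div_mul_right _ _ hD.ne']
        unfold totalRate
        field_simp
        ring
      rw [h1]
      refine add_le_add_right (sub_le_sub ?_ ?_) _
      · rw [div_le_iff₀ (by positivity), inv_mul_cancel_left₀ hN0.ne']
        unfold totalRate
        have : 0 ≤ (x.length : ℝ) * a := by positivity
        linarith
      · rw [div_pow, ← mul_div_assoc, div_le_div_iff₀ (by positivity) (by positivity)]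
        have := mul_length_le_totalRate (a := a) hl x
        have h3 : a * (x.length + 1) ≤ 2 * totalRate a l x := by nlinarith
        have h4 : 0 ≤ a * excess x ^ 2 * totalRate a l x / 2 := by positivity
        nlinarith [mul_le_mul_of_nonneg_left h3 h4]
    rw [chainExp_add, chainExp_sub, chainExp_const_mul] at key
    linarith

theorem sum_chainExp_abs_excess_div_sq_le {a l : ℝ} (ha : 0 < a) (hl : 0 < l) (t : ℕ) :
    (∑ s ∈ Finset.range t, chainExp a l l s fun x => |excess x / totalRate a l x|) ^ 2 ≤
      t * (2 / a ^ 2 * ∑ s ∈ Finset.range t, chainExp a l l s fun x => (x.length : ℝ)⁻¹) := by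
  refine sq_sum_le_card_mul_sum_sq.trans ?_
  rw [Finset.card_range]
  refine mul_le_mul_of_nonneg_left ?_ t.cast_nonneg
  have h := sum_chainExp_excess_div_sq_le ha hl t
  have h2 : ∑ s ∈ Finset.range t,
      (chainExp a l l s fun x => |excess x / totalRate a l x|) ^ 2 ≤
      ∑ s ∈ Finset.range t, chainExp a l l s (fun x => (excess x / totalRate a l x) ^ 2) := by
    refine Finset.sum_le_sum fun s _ => ?_
    simpa only [sq_abs] using sq_chainExp_le ha hl s fun x => |excess x / totalRate a l x|
  rw [div_mul_eq_mul_div, le_div_iff₀ (by positivity)]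
  nlinarith

theorem tendsto_zero_of_sq_le {f g : ℕ → ℝ} (hf : ∀ t, 0 ≤ f t) (hfg : ∀ t, f t ^ 2 ≤ g t)
    (hg : Tendsto g atTop (𝓝 0)) : Tendsto f atTop (𝓝 0) := by
  refine squeeze_zero hf (fun t => Real.le_sqrt_of_sq_le (hfg t)) ?_
  simpa using hg.sqrt

theorem tendsto_cesaro_abs_excess {a l : ℝ} (ha : 0 < a) (hl : 0 < l) :
    Tendsto (fun t : ℕ => (t : ℝ)⁻¹ *
      ∑ s ∈ Finset.range t, chainExp a l l s fun x => |excess x / totalRate a l x|)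
      atTop (𝓝 0) := by
  have h := (tendsto_chainExp_inv_length ha hl).cesaro.const_mul (2 / a ^ 2)
  rw [mul_zero] at h
  refine tendsto_zero_of_sq_le (fun t => mul_nonneg (by positivity)
    (Finset.sum_nonneg fun s _ => chainExp_nonneg ha hl fun x _ => abs_nonneg _)) (fun t => ?_) h
  have h1 := sum_chainExp_abs_excess_div_sq_le ha hl t
  rcases t.eq_zero_or_pos with rfl | ht
  · simp
  · have ht' : (0 : ℝ) < t := by exact_mod_cast ht
    rw [mul_pow, inv_pow, inv_mul_le_iff₀ (by positivity)]
    refine h1.trans_eq ?_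
    field_simp

theorem chainExp_length_sub_sq_le {a l : ℝ} (ha : 0 < a) (hl : 0 < l) (t : ℕ) :
    chainExp a l l t (fun x => (x.length - a / (2 * l + a) * (t + 1)) ^ 2) ≤
      1 + t + 4 * l * t *
        ∑ s ∈ Finset.range t, chainExp a l l s fun x => |excess x / totalRate a l x| := by
  have hc : 0 < 2 * l + a := by positivity
  set ρ := a / (2 * l + a) with hρ
  have hρ0 : 0 ≤ ρ := by positivity
  have hρ1 : ρ ≤ 1 := by
    rw [hρ, div_le_one hc]
    linarith
  induction t with
  | zero =>
    simp only [chainExp_zero, List.length_singleton, Nat.cast_one, Nat.cast_zero]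
    norm_num
    rw [abs_le]
    constructor <;> linarith
  | succ t ih =>
    rw [chainExp_succ, Finset.sum_range_succ]
    have key : chainExp a l l t
        (stepOp a l l fun x => (x.length - ρ * ((t + 1 : ℕ) + 1)) ^ 2) ≤
        chainExp a l l t (fun x => (x.length - ρ * (t + 1)) ^ 2 +
          (1 + 4 * l * (t + 1) * |excess x / totalRate a l x|)) := by
      refine chainExp_mono ha.le hl.le hl.le fun x hx => ?_
      have hD := totalRate_pos ha hl hx.1
      have hN := hx.one_le_length
      have hNt : (x.length : ℝ) ≤ t + 1 := by exact_mod_cast hx.2.1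
      refine (stepOp_length_sum a l (fun n _ => (n - ρ * ((t + 1 : ℕ) + 1)) ^ 2) x).trans_le ?_
      simp only [Nat.cast_add, Nat.cast_one]
      set R := (x.length : ℝ) - ρ * (t + 1) with hR
      set p := a * x.length / totalRate a l x with hp
      have hp0 : 0 ≤ p := by positivity
      have hp1 : p ≤ 1 := (div_le_one hD).2 (mul_length_le_totalRate hl x)
      have hpρ : p - ρ = -(2 * l * ρ) * (excess x / totalRate a l x) := by
        have h1 := totalRate_eq a l x
        rw [hp, hρ]
        field_simp
        rw [h1]
        ring
      have hRabs : |R| ≤ t + 1 := by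
        have : 0 ≤ ρ * (t + 1) := by positivity
        have : ρ * (t + 1) ≤ t + 1 := mul_le_of_le_one_left (by positivity) hρ1
        rw [abs_le]
        constructor <;> linarith
      have h1 : (l * x.sum * (((x.length : ℝ) - ρ * (t + 1 + 1)) ^ 2 +
          ((x.length : ℝ) - ρ * (t + 1 + 1)) ^ 2) +
          a * x.length * ((x.length : ℝ) + 1 - ρ * (t + 1 + 1)) ^ 2) / totalRate a l x =
          (R - ρ) ^ 2 + p * (2 * (R - ρ) + 1) := by
        have h2 : (x.length : ℝ) - ρ * (t + 1 + 1) = R - ρ := by rw [hR]; ring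
        have h3 : (x.length : ℝ) + 1 - ρ * (t + 1 + 1) = R - ρ + 1 := by rw [hR]; ring
        rw [h2, h3, hp, div_eq_iff hD.ne', add_mul, div_mul_eq_mul_div, div_mul_cancel₀ _ hD.ne']
        unfold totalRate
        ring
      rw [h1]
      have h2 : 2 * R * (p - ρ) ≤ 4 * l * (t + 1) * |excess x / totalRate a l x| := by
        calc 2 * R * (p - ρ) ≤ |2 * R * (p - ρ)| := le_abs_self _
          _ = 2 * |R| * (2 * l * ρ * |excess x / totalRate a l x|) := by
            rw [hpρ, abs_mul, abs_mul, abs_mul, abs_neg, abs_two,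
              abs_of_nonneg (by positivity : 0 ≤ 2 * l * ρ)]
          _ ≤ 2 * (t + 1) * (2 * l * 1 * |excess x / totalRate a l x|) := by gcongr
          _ = _ := by ring
      nlinarith [mul_nonneg hp0 hρ0, mul_nonneg hp0 (sub_nonneg.2 hρ1),
        mul_nonneg (sub_nonneg.2 hp1) hρ0, mul_nonneg (sub_nonneg.2 hp1) (sub_nonneg.2 hρ1),
        mul_nonneg hρ0 (sub_nonneg.2 hρ1)]
    rw [chainExp_add, chainExp_add, chainExp_const ha hl, chainExp_const_mul] at key
    have hs : 0 ≤ ∑ s ∈ Finset.range t, chainExp a l l s fun x => |excess x / totalRate a l x| :=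
      Finset.sum_nonneg fun s _ => chainExp_nonneg ha hl fun x _ => abs_nonneg _
    have := mul_nonneg hl.le hs
    push_cast at key ⊢
    linarith

theorem tendsto_chainExp_abs_length {a l : ℝ} (ha : 0 < a) (hl : 0 < l) :
    Tendsto (fun t : ℕ => chainExp a l l t fun x => |x.length / ((t : ℝ) + 1) - a / (2 * l + a)|)
      atTop (𝓝 0) := by
  have h := (tendsto_one_div_add_atTop_nhds_zero_nat (𝕜 := ℝ)).add
    ((tendsto_cesaro_abs_excess ha hl).const_mul (4 * l))
  rw [mul_zero, add_zero] at h
  refine tendsto_zero_of_sq_le (fun t => chainExp_nonneg ha hl fun x _ => abs_nonneg _)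
    (fun t => ?_) h
  refine (sq_chainExp_le ha hl t _).trans ?_
  have ht : (0 : ℝ) < t + 1 := by positivity
  have h1 : (chainExp a l l t fun x => |x.length / ((t : ℝ) + 1) - a / (2 * l + a)| ^ 2) =
      ((t + 1 : ℝ) ^ 2)⁻¹ *
        chainExp a l l t (fun x => (x.length - a / (2 * l + a) * (t + 1)) ^ 2) := by
    rw [← chainExp_const_mul]
    congr 1
    funext x
    rw [sq_abs]
    field_simp
  rw [h1, inv_mul_le_iff₀ (by positivity)]
  refine (chainExp_length_sub_sq_le ha hl t).trans ?_
  set S := ∑ s ∈ Finset.range t, chainExp a l l s fun x => |excess x / totalRate a l x|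
  have hs : 0 ≤ S :=
    Finset.sum_nonneg fun s _ => chainExp_nonneg ha hl fun x _ => abs_nonneg _
  have h2 : (t : ℝ) * S ≤ (t + 1) ^ 2 * ((t : ℝ)⁻¹ * S) := by
    rcases t.eq_zero_or_pos with h0 | h0
    · simp [h0]
    · have ht' : (0 : ℝ) < t := by exact_mod_cast h0
      rw [← mul_assoc]
      refine mul_le_mul_of_nonneg_right ?_ hs
      rw [← div_eq_mul_inv, le_div_iff₀ ht']
      nlinarith
  have h3 : ((t : ℝ) + 1) ^ 2 * (1 / (t + 1)) = 1 + t := by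
    field_simp
    ring
  rw [mul_add, h3]
  nlinarith [mul_le_mul_of_nonneg_left h2 hl.le]

theorem tendsto_chainExp_abs_excess {a l : ℝ} (ha : 0 < a) (hl : 0 < l) :
    Tendsto (fun t : ℕ => chainExp a l l t fun x => |excess x / totalRate a l x|)
      atTop (𝓝 0) := by
  set ρ := a / (2 * l + a) with hρ
  have hρ0 : 0 < ρ := by positivity
  have hE : Tendsto (fun t : ℕ => ((t : ℝ) + 1)⁻¹ * chainExp a l l t fun x => |excess x|)
      atTop (𝓝 0) := by
    refine tendsto_zero_of_sq_le (fun t => mul_nonneg (by positivity)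
      (chainExp_nonneg ha hl fun x _ => abs_nonneg _)) (fun t => ?_)
      (tendsto_one_div_add_atTop_nhds_zero_nat (𝕜 := ℝ))
    have h1 := sq_chainExp_le ha hl t fun x => |excess x|
    simp only [sq_abs] at h1
    have h2 := h1.trans (chainExp_excess_sq_le ha hl t)
    rw [mul_pow, inv_pow, inv_mul_le_iff₀ (by positivity)]
    refine h2.trans ?_
    have : ((t : ℝ) + 1) ^ 2 * (1 / (t + 1)) = 1 + t := by
      field_simp
      ring
    linarith
  have h := (hE.const_mul (2 / (a * ρ))).add
    ((tendsto_chainExp_abs_length ha hl).const_mul (2 / ρ * (1 / (2 * l) + 1 / a)))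
  rw [mul_zero, mul_zero, add_zero] at h
  refine squeeze_zero (fun t => chainExp_nonneg ha hl fun x _ => abs_nonneg _) (fun t => ?_) h
  rw [← chainExp_const_mul, ← chainExp_const_mul, ← chainExp_const_mul, ← chainExp_add]
  refine chainExp_mono ha.le hl.le hl.le fun x hx => ?_
  have hD := totalRate_pos ha hl hx.1
  have hN := hx.one_le_length
  have ht : (0 : ℝ) < t + 1 := by positivity
  rw [abs_div, abs_of_pos hD, ← hρ]
  have haN := mul_length_le_totalRate (a := a) hl x
  rcases le_total (ρ * (t + 1) / 2) x.length with hcase | hcase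
  · refine le_add_of_le_of_nonneg ?_ (by positivity)
    rw [div_eq_inv_mul, ← mul_assoc]
    refine mul_le_mul_of_nonneg_right ?_ (abs_nonneg _)
    rw [div_eq_mul_inv, inv_eq_one_div, inv_eq_one_div, inv_eq_one_div, mul_one_div, mul_one_div,
      div_div, div_le_div_iff₀ hD (by positivity)]
    nlinarith
  · refine le_add_of_nonneg_of_le (by positivity) ?_
    have h1 : |excess x| / totalRate a l x ≤ 1 / (2 * l) + 1 / a := by
      rw [div_le_iff₀ hD]
      have h2 : (x.sum : ℝ) ≤ 1 / (2 * l) * totalRate a l x := by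
        rw [one_div, le_inv_mul_iff₀ (by positivity)]
        unfold totalRate
        nlinarith
      have h3 : (x.length : ℝ) ≤ 1 / a * totalRate a l x := by
        rw [one_div, le_inv_mul_iff₀ ha]
        exact haN
      have h4 : (0 : ℝ) ≤ x.sum := by positivity
      rw [abs_le, add_mul]
      unfold excess
      constructor <;> linarith
    have h5 : ρ / 2 ≤ |x.length / ((t : ℝ) + 1) - ρ| := by
      refine le_trans ?_ (neg_le_abs _)
      have : x.length / ((t : ℝ) + 1) ≤ ρ / 2 := by
        rw [div_le_iff₀ ht]
        linarith
      linarith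
    calc |excess x| / totalRate a l x ≤ 1 / (2 * l) + 1 / a := h1
      _ = 2 / ρ * (1 / (2 * l) + 1 / a) * (ρ / 2) := by field_simp
      _ ≤ _ := mul_le_mul_of_nonneg_left h5 (by positivity)

/-- The error made when the transition rates are replaced by their deterministic
asymptotic values. -/
noncomputable def rateError (a l : ℝ) (t : ℕ) (x : List ℕ) : ℝ :=
  |excess x / totalRate a l x| + |x.length / ((t : ℝ) + 1) - a / (2 * l + a)|

theorem tendsto_chainExp_rateError {a l : ℝ} (ha : 0 < a) (hl : 0 < l) :
    Tendsto (fun t : ℕ => chainExp a l l t (rateError a l t)) atTop (𝓝 0) := by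
  have h := (tendsto_chainExp_abs_excess ha hl).add (tendsto_chainExp_abs_length ha hl)
  simp only [← chainExp_add, add_zero] at h
  exact h

theorem abs_length_div_totalRate_sub_le {a l : ℝ} (ha : 0 < a) (hl : 0 < l) {t : ℕ} {x : List ℕ}
    (hx : 1 ≤ x.length) :
    |x.length / totalRate a l x - 1 / (2 * l + a)| ≤ rateError a l t x := by
  have hD := totalRate_pos ha hl hx
  have h : x.length / totalRate a l x - 1 / (2 * l + a) =
      -(2 * l / (2 * l + a)) * (excess x / totalRate a l x) := by
    have h1 := totalRate_eq a l x
    field_simp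
    rw [h1]
    ring
  rw [h, abs_mul, abs_neg, abs_of_pos (by positivity)]
  refine le_add_of_le_of_nonneg (mul_le_of_le_one_left (abs_nonneg _) ?_) (abs_nonneg _)
  rw [div_le_one (by positivity)]
  linarith

theorem abs_length_div_totalRate_sub_div_le {a l : ℝ} (ha : 0 < a) (hl : 0 < l) {t : ℕ}
    {x : List ℕ} (hx : 1 ≤ x.length) :
    |x.length / totalRate a l x - x.length / (a * (t + 1))| ≤
      (1 + 1 / a) * rateError a l t x := by
  have h1 := abs_length_div_totalRate_sub_le ha hl (t := t) hx
  have h2 : |1 / (2 * l + a) - x.length / (a * ((t : ℝ) + 1))| ≤ 1 / a * rateError a l t x := by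
    have : 1 / (2 * l + a) - x.length / (a * ((t : ℝ) + 1)) =
        -(1 / a) * (x.length / ((t : ℝ) + 1) - a / (2 * l + a)) := by
      field_simp
      ring
    rw [this, abs_mul, abs_neg, abs_of_pos (by positivity)]
    exact mul_le_mul_of_nonneg_left (le_add_of_nonneg_left (abs_nonneg _)) (by positivity)
  have h3 := abs_sub_le (x.length / totalRate a l x) (1 / (2 * l + a))
    (x.length / (a * ((t : ℝ) + 1)))
  linarith

theorem nat_mul_pow_mul_one_sub_le {s : ℝ} (h0 : 0 ≤ s) (h1 : s ≤ 1) (k : ℕ) :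
    (k : ℝ) * s ^ (k - 1) * (1 - s) ≤ 1 := by
  cases k with
  | zero => simp
  | succ k =>
    have key : ((k : ℝ) + 1) * s ^ k * (1 - s) ≤ 1 - s ^ (k + 1) := by
      induction k with
      | zero => simp
      | succ k ih =>
        have h2 : 0 ≤ (1 - s) * (1 - s ^ (k + 1)) :=
          mul_nonneg (by linarith) (sub_nonneg.2 (pow_le_one₀ h0 h1))
        have h3 := mul_le_mul_of_nonneg_left ih h0
        push_cast
        calc ((k : ℝ) + 1 + 1) * s ^ (k + 1) * (1 - s)
            = s * (((k : ℝ) + 1) * s ^ k * (1 - s)) + s ^ (k + 1) * (1 - s) := by ring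
          _ ≤ s * (1 - s ^ (k + 1)) + s ^ (k + 1) * (1 - s) := by linarith
          _ = 1 - s ^ (k + 1 + 1) - (1 - s) * (1 - s ^ (k + 1)) := by ring
          _ ≤ 1 - s ^ (k + 1 + 1) := by linarith
    have : 0 ≤ s ^ (k + 1) := by positivity
    rw [Nat.add_sub_cancel, Nat.cast_add, Nat.cast_one]
    linarith

theorem abs_pow_sub_pow_sub_le {s r : ℝ} (h0 : 0 ≤ s) (hsr : s ≤ r) (h1 : r < 1) (k : ℕ) :
    |r ^ k - s ^ k - k * s ^ (k - 1) * (r - s)| ≤ (r - s) ^ 2 / (1 - r) ^ 2 := by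
  have hr : 0 < 1 - r := by linarith
  have hr0 : 0 ≤ r := h0.trans hsr
  suffices h : 0 ≤ r ^ k - s ^ k - k * s ^ (k - 1) * (r - s) ∧
      r ^ k - s ^ k - k * s ^ (k - 1) * (r - s) ≤ (r - s) ^ 2 / (1 - r) ^ 2 by
    rw [abs_of_nonneg h.1]
    exact h.2
  induction k with
  | zero => simpa using div_nonneg (sq_nonneg (r - s)) (sq_nonneg (1 - r))
  | succ k ih =>
    have hrec : r ^ (k + 1) - s ^ (k + 1) - ((k + 1 : ℕ) : ℝ) * s ^ (k + 1 - 1) * (r - s) =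
        r * (r ^ k - s ^ k - k * s ^ (k - 1) * (r - s)) + k * s ^ (k - 1) * (r - s) ^ 2 := by
      cases k with
      | zero => simp
      | succ k =>
        simp only [Nat.add_sub_cancel]
        push_cast
        ring
    rw [hrec]
    have hk0 : 0 ≤ (k : ℝ) * s ^ (k - 1) := by positivity
    have hk : (k : ℝ) * s ^ (k - 1) ≤ 1 / (1 - r) := by
      rw [le_div_iff₀ hr]
      refine le_trans ?_ (nat_mul_pow_mul_one_sub_le hr0 h1.le k)
      gcongr
    refine ⟨add_nonneg (mul_nonneg hr0 ih.1) (mul_nonneg hk0 (sq_nonneg _)), ?_⟩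
    calc r * (r ^ k - s ^ k - k * s ^ (k - 1) * (r - s)) + k * s ^ (k - 1) * (r - s) ^ 2
        ≤ r * ((r - s) ^ 2 / (1 - r) ^ 2) + 1 / (1 - r) * (r - s) ^ 2 :=
          add_le_add (mul_le_mul_of_nonneg_left ih.2 hr0)
            (mul_le_mul_of_nonneg_right hk (sq_nonneg _))
      _ = (r - s) ^ 2 / (1 - r) ^ 2 := by
        field_simp
        ring

/-- The function `k ↦ s ^ k` with `s = 1 - 1 / u`. The critical birth-death semigroup acts on these
functions by translation of `u`. -/
noncomputable def genFun (u : ℝ) (k : ℕ) : ℝ := (1 - 1 / u) ^ k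

/-- The critical birth-death generator applied to `genFun u`. -/
noncomputable def genFunDeriv (u : ℝ) (k : ℕ) : ℝ :=
  (k : ℝ) * (genFun u (k + 1) - 2 * genFun u k + genFun u (k - 1))

theorem genFunDeriv_eq (u : ℝ) (k : ℕ) :
    genFunDeriv u k = k * (1 - 1 / u) ^ (k - 1) * (1 / u) ^ 2 := by
  cases k with
  | zero => simp [genFunDeriv]
  | succ k =>
    simp only [genFunDeriv, genFun, Nat.add_sub_cancel]
    ring

theorem one_sub_one_div_mem {u : ℝ} (hu : 1 ≤ u) : 0 ≤ 1 - 1 / u ∧ 1 - 1 / u ≤ 1 := by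
  have h1 : 1 / u ≤ 1 := (div_le_one (by linarith)).2 hu
  have h2 : 0 ≤ 1 / u := by positivity
  constructor <;> linarith

theorem abs_genFunDeriv_le {u : ℝ} (hu : 1 ≤ u) (k : ℕ) : |genFunDeriv u k| ≤ 1 := by
  obtain ⟨h0, h1⟩ := one_sub_one_div_mem hu
  have h2 := nat_mul_pow_mul_one_sub_le h0 h1 k
  have h3 : 0 ≤ 1 / u := by positivity
  rw [genFunDeriv_eq, abs_of_nonneg (by positivity), pow_two, ← mul_assoc]
  rw [sub_sub_cancel] at h2
  nlinarith

theorem abs_genFun_add_sub_le {u h : ℝ} (hu : 1 ≤ u) (hh : 0 ≤ h) (k : ℕ) :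
    |genFun (u + h) k - genFun u k - h * genFunDeriv u k| ≤ 2 * h ^ 2 := by
  obtain ⟨h0, h1⟩ := one_sub_one_div_mem hu
  have hu0 : 0 < u := by linarith
  have huh : 0 < u + h := by linarith
  have hle : 1 - 1 / u ≤ 1 - 1 / (u + h) :=
    sub_le_sub_left (one_div_le_one_div_of_le hu0 (by linarith)) _
  have hlt : 1 - 1 / (u + h) < 1 := by
    have : 0 < 1 / (u + h) := by positivity
    linarith
  have hB := abs_pow_sub_pow_sub_le h0 hle hlt k
  have hd : 1 - 1 / (u + h) - (1 - 1 / u) = h / (u * (u + h)) := by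
    field_simp
    ring
  have hB' : (1 - 1 / (u + h) - (1 - 1 / u)) ^ 2 / (1 - (1 - 1 / (u + h))) ^ 2 ≤ h ^ 2 := by
    have : (1 - 1 / (u + h) - (1 - 1 / u)) ^ 2 / (1 - (1 - 1 / (u + h))) ^ 2 = h ^ 2 / u ^ 2 := by
      rw [hd]
      field_simp
      ring
    rw [this]
    exact div_le_self (sq_nonneg _) (one_le_pow₀ hu)
  have hC : |(k : ℝ) * (1 - 1 / u) ^ (k - 1) * (1 - 1 / (u + h) - (1 - 1 / u)) -
      h * genFunDeriv u k| ≤ h ^ 2 := by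
    have e : (k : ℝ) * (1 - 1 / u) ^ (k - 1) * (1 - 1 / (u + h) - (1 - 1 / u)) -
        h * genFunDeriv u k =
        -((k : ℝ) * (1 - 1 / u) ^ (k - 1) * (1 - (1 - 1 / u)) * (h ^ 2 / (u * (u + h)))) := by
      rw [genFunDeriv_eq, hd]
      field_simp
      ring
    rw [e, abs_neg, sub_sub_cancel, abs_of_nonneg (by positivity)]
    have h2 := nat_mul_pow_mul_one_sub_le h0 h1 k
    rw [sub_sub_cancel] at h2
    refine (mul_le_of_le_one_left (by positivity) h2).trans ?_
    refine div_le_self (sq_nonneg _) ?_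
    nlinarith
  have e : genFun (u + h) k - genFun u k - h * genFunDeriv u k =
      ((1 - 1 / (u + h)) ^ k - (1 - 1 / u) ^ k -
        k * (1 - 1 / u) ^ (k - 1) * (1 - 1 / (u + h) - (1 - 1 / u))) +
      ((k : ℝ) * (1 - 1 / u) ^ (k - 1) * (1 - 1 / (u + h) - (1 - 1 / u)) -
        h * genFunDeriv u k) := by
    unfold genFun
    ring
  rw [e]
  refine (abs_add_le _ _).trans ?_
  linarith [hB.trans hB']

theorem abs_sum_map_le (f : ℕ → ℝ) {c : ℝ} (hf : ∀ k, |f k| ≤ c) (x : List ℕ) :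
    |(x.map f).sum| ≤ c * x.length := by
  rw [← sum_range_getD]
  refine (Finset.abs_sum_le_sum_abs _ _).trans
    ((Finset.sum_le_sum fun i _ => hf (x.getD i 0)).trans_eq ?_)
  simp [mul_comm]

theorem abs_stepOp_genFun_sub_le {a l : ℝ} (ha : 0 < a) (hl : 0 < l) {u : ℝ} (hu : 1 ≤ u) {t : ℕ}
    {x : List ℕ} (hx : Reachable t x) :
    |stepOp a l l (fun x => (x.map (genFun u)).sum) x -
        ((x.map (genFun (u + l / (a * (t + 1))))).sum + a / (2 * l + a) * (1 - 1 / u))| ≤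
      (l * (1 + 1 / a) + a) * rateError a l t x + 2 * (l / a) ^ 2 * (1 / (t + 1)) := by
  obtain ⟨hs0, hs1⟩ := one_sub_one_div_mem hu
  have hD := totalRate_pos ha hl hx.1
  have hN := hx.one_le_length
  have hNt : (x.length : ℝ) ≤ t + 1 := by exact_mod_cast hx.2.1
  have ht : (0 : ℝ) < t + 1 := by positivity
  set h := l / (a * ((t : ℝ) + 1)) with hh
  have hh0 : 0 ≤ h := by positivity
  have h1 : stepOp a l l (fun x => (x.map (genFun u)).sum) x = (x.map (genFun u)).sum +
      (l * (x.map (genFunDeriv u)).sum + a * x.length * (1 - 1 / u)) / totalRate a l x := by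
    have h2 : genFun u 1 = 1 - 1 / u := pow_one _
    rw [stepOp_sum_map ha hl _ hx.1, h2]
    rfl
  have hA : |(x.map (genFun (u + h))).sum - (x.map (genFun u)).sum -
      h * (x.map (genFunDeriv u)).sum| ≤ 2 * (l / a) ^ 2 * (1 / (t + 1)) := by
    have e : (x.map (genFun (u + h))).sum - (x.map (genFun u)).sum -
        h * (x.map (genFunDeriv u)).sum =
        (x.map fun k => genFun (u + h) k - genFun u k - h * genFunDeriv u k).sum := by
      simp only [← sum_range_getD, Finset.sum_sub_distrib, Finset.mul_sum]
    rw [e]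
    refine (abs_sum_map_le _ (abs_genFun_add_sub_le hu hh0) x).trans ?_
    calc 2 * h ^ 2 * x.length ≤ 2 * h ^ 2 * (t + 1) := by gcongr
      _ = _ := by
        rw [hh]
        field_simp
  have hB : |l * (x.map (genFunDeriv u)).sum / totalRate a l x -
      h * (x.map (genFunDeriv u)).sum| ≤ l * ((1 + 1 / a) * rateError a l t x) := by
    have e : l * (x.map (genFunDeriv u)).sum / totalRate a l x -
        h * (x.map (genFunDeriv u)).sum =
        l * (x.map (genFunDeriv u)).sum * (1 / totalRate a l x - 1 / (a * (t + 1))) := by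
      rw [hh]
      ring
    have e2 : x.length / totalRate a l x - x.length / (a * (t + 1)) =
        x.length * (1 / totalRate a l x - 1 / (a * (t + 1))) := by ring
    have h2 := abs_length_div_totalRate_sub_div_le ha hl (t := t) hx.1
    have h3 := abs_sum_map_le _ (abs_genFunDeriv_le hu) x
    rw [e2, abs_mul, Nat.abs_cast] at h2
    rw [one_mul] at h3
    rw [e, abs_mul, abs_mul, abs_of_pos hl, mul_assoc]
    refine mul_le_mul_of_nonneg_left ?_ hl.le
    exact (mul_le_mul_of_nonneg_right h3 (abs_nonneg _)).trans h2
  have hC : |a * x.length * (1 - 1 / u) / totalRate a l x - a / (2 * l + a) * (1 - 1 / u)| ≤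
      a * rateError a l t x := by
    have e : a * x.length * (1 - 1 / u) / totalRate a l x - a / (2 * l + a) * (1 - 1 / u) =
        a * ((x.length / totalRate a l x - 1 / (2 * l + a)) * (1 - 1 / u)) := by ring
    rw [e, abs_mul, abs_mul, abs_of_pos ha, abs_of_nonneg hs0]
    refine mul_le_mul_of_nonneg_left ?_ ha.le
    exact (mul_le_of_le_one_right (abs_nonneg _) hs1).trans
      (abs_length_div_totalRate_sub_le ha hl hx.1)
  rw [h1]
  have e : (x.map (genFun u)).sum +
      (l * (x.map (genFunDeriv u)).sum + a * x.length * (1 - 1 / u)) / totalRate a l x -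
      ((x.map (genFun (u + h))).sum + a / (2 * l + a) * (1 - 1 / u)) =
      -((x.map (genFun (u + h))).sum - (x.map (genFun u)).sum -
        h * (x.map (genFunDeriv u)).sum) +
      (l * (x.map (genFunDeriv u)).sum / totalRate a l x - h * (x.map (genFunDeriv u)).sum) +
      (a * x.length * (1 - 1 / u) / totalRate a l x - a / (2 * l + a) * (1 - 1 / u)) := by
    ring
  rw [e]
  refine (abs_add_three _ _ _).trans ?_
  rw [abs_neg]
  linarith

theorem abs_chainExp_genFun_succ_sub_le {a l : ℝ} (ha : 0 < a) (hl : 0 < l) {u : ℝ} (hu : 1 ≤ u)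
    (t : ℕ) :
    |chainExp a l l (t + 1) (fun x => (x.map (genFun u)).sum) -
        (chainExp a l l t (fun x => (x.map (genFun (u + l / (a * (t + 1))))).sum) +
          a / (2 * l + a) * (1 - 1 / u))| ≤
      (l * (1 + 1 / a) + a) * chainExp a l l t (rateError a l t) +
        2 * (l / a) ^ 2 * (1 / (t + 1)) := by
  have h : chainExp a l l (t + 1) (fun x => (x.map (genFun u)).sum) -
        (chainExp a l l t (fun x => (x.map (genFun (u + l / (a * (t + 1))))).sum) +
          a / (2 * l + a) * (1 - 1 / u)) =
      chainExp a l l t (fun x => stepOp a l l (fun x => (x.map (genFun u)).sum) x -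
        ((x.map (genFun (u + l / (a * (t + 1))))).sum + a / (2 * l + a) * (1 - 1 / u))) := by
    rw [chainExp_sub, chainExp_add, chainExp_const ha hl, chainExp_succ]
  rw [h]
  refine (abs_chainExp_le ha hl t _).trans ?_
  refine (chainExp_mono ha.le hl.le hl.le fun x hx => abs_stepOp_genFun_sub_le ha hl hu hx).trans ?_
  rw [chainExp_add, chainExp_const ha hl, chainExp_const_mul]

/-- The integral `∫₀^∞ e^(-θ r) (u + r)^(-2) dr`. -/
noncomputable def laplaceSq (θ u : ℝ) : ℝ :=
  ∫ r in Set.Ioi (0 : ℝ), Real.exp (-θ * r) * (1 / (u + r) ^ 2)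

/-- The generating function of the limiting in-degree distribution at the point `1 - 1 / u`. -/
noncomputable def limitGen (θ u : ℝ) : ℝ := 1 - 1 / u + laplaceSq θ u

theorem integrableOn_exp_mul {θ : ℝ} (hθ : 0 < θ) {f : ℝ → ℝ} (hf : ContinuousOn f (Set.Ioi 0))
    {c : ℝ} (hc : ∀ r, 0 < r → |f r| ≤ c) :
    IntegrableOn (fun r => Real.exp (-θ * r) * f r) (Set.Ioi 0) := by
  refine ((exp_neg_integrableOn_Ioi 0 hθ).mul_const c).mono' ?_ ?_
  · refine ContinuousOn.aestronglyMeasurable ?_ measurableSet_Ioi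
    exact (Continuous.continuousOn (by fun_prop)).mul hf
  · filter_upwards [self_mem_ae_restrict measurableSet_Ioi] with r hr
    rw [Real.norm_eq_abs, abs_mul, Real.abs_exp]
    exact mul_le_mul_of_nonneg_left (hc r hr) (Real.exp_pos _).le

theorem abs_integral_exp_mul_le {θ : ℝ} (hθ : 0 < θ) {f : ℝ → ℝ} {c : ℝ}
    (hc : ∀ r, 0 < r → |f r| ≤ c) :
    |∫ r in Set.Ioi (0 : ℝ), Real.exp (-θ * r) * f r| ≤ c / θ := by
  have h : ∫ r in Set.Ioi (0 : ℝ), Real.exp (-θ * r) * c = c / θ := by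
    rw [integral_mul_const, integral_exp_mul_Ioi (by linarith)]
    simp [div_eq_mul_inv, mul_comm]
  rw [← h, ← Real.norm_eq_abs]
  refine norm_integral_le_of_norm_le ((exp_neg_integrableOn_Ioi 0 hθ).mul_const c) ?_
  filter_upwards [self_mem_ae_restrict measurableSet_Ioi] with r hr
  rw [Real.norm_eq_abs, abs_mul, Real.abs_exp]
  exact mul_le_mul_of_nonneg_left (hc r hr) (Real.exp_pos _).le

theorem continuousOn_one_div_add {u : ℝ} (hu : 1 ≤ u) :
    ContinuousOn (fun r : ℝ => 1 / (u + r)) (Set.Ioi 0) := by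
  refine ContinuousOn.div (by fun_prop) (by fun_prop) fun r hr => ?_
  have : 0 < r := hr
  positivity

theorem abs_one_div_add_le {u : ℝ} (hu : 1 ≤ u) {r : ℝ} (hr : 0 < r) : |1 / (u + r)| ≤ 1 := by
  rw [abs_of_nonneg (by positivity), div_le_one (by positivity)]
  linarith

theorem integrableOn_exp_mul_one_div {θ u : ℝ} (hθ : 0 < θ) (hu : 1 ≤ u) :
    IntegrableOn (fun r => Real.exp (-θ * r) * (1 / (u + r))) (Set.Ioi 0) :=
  integrableOn_exp_mul hθ (continuousOn_one_div_add hu) fun _ hr => abs_one_div_add_le hu hr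

theorem integrableOn_exp_mul_one_div_sq {θ u : ℝ} (hθ : 0 < θ) (hu : 1 ≤ u) :
    IntegrableOn (fun r => Real.exp (-θ * r) * (1 / (u + r) ^ 2)) (Set.Ioi 0) := by
  refine integrableOn_exp_mul hθ (c := 1) ?_ fun r hr => ?_
  · exact ((continuousOn_one_div_add hu).pow 2).congr fun r _ => by simp
  · rw [← one_div_pow, abs_pow]
    exact pow_le_one₀ (abs_nonneg _) (abs_one_div_add_le hu hr)

theorem mul_integral_exp_mul_one_div {θ u : ℝ} (hθ : 0 < θ) (hu : 1 ≤ u) :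
    θ * ∫ r in Set.Ioi (0 : ℝ), Real.exp (-θ * r) * (1 / (u + r)) = 1 / u - laplaceSq θ u := by
  have hI := (integrableOn_exp_mul_one_div hθ hu).const_mul θ
  have hJ := integrableOn_exp_mul_one_div_sq hθ hu
  have hIJ : IntegrableOn (fun r => θ * (Real.exp (-θ * r) * (1 / (u + r))) +
      Real.exp (-θ * r) * (1 / (u + r) ^ 2)) (Set.Ioi 0) := hI.add hJ
  have h := integral_Ioi_of_hasDerivAt_of_tendsto' (a := 0) (m := 0)
    (f := fun r => -(Real.exp (-θ * r) * (1 / (u + r))))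
    (f' := fun r => θ * (Real.exp (-θ * r) * (1 / (u + r))) +
      Real.exp (-θ * r) * (1 / (u + r) ^ 2)) ?_ hIJ ?_
  · rw [integral_add hI hJ, integral_const_mul] at h
    simp at h
    simp only [laplaceSq, one_div, neg_mul]
    linarith
  · intro r hr
    have hr' : 0 ≤ r := hr
    have hne : u + r ≠ 0 := by positivity
    have h1 : HasDerivAt (fun r => Real.exp (-θ * r)) (Real.exp (-θ * r) * (-θ * 1)) r :=
      ((hasDerivAt_id r).const_mul (-θ)).exp
    have h2 : HasDerivAt (fun r => 1 / (u + r)) (-(1 / (u + r) ^ 2)) r := by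
      simpa [neg_div] using ((hasDerivAt_id r).const_add u).fun_inv hne
    exact (h1.mul h2).neg.congr_deriv (by ring)
  · have h1 : Tendsto (fun r : ℝ => Real.exp (-θ * r)) atTop (𝓝 0) := by
      simp only [neg_mul]
      exact Real.tendsto_exp_neg_atTop_nhds_zero.comp (tendsto_id.const_mul_atTop hθ)
    have h2 : Tendsto (fun r : ℝ => 1 / (u + r)) atTop (𝓝 0) := by
      simp only [one_div]
      exact tendsto_inv_atTop_zero.comp (tendsto_atTop_add_const_left _ u tendsto_id)
    simpa using (h1.mul h2).neg

theorem abs_limitGen_le {θ u : ℝ} (hθ : 0 < θ) (hu : 1 ≤ u) : |limitGen θ u| ≤ 1 + 1 / θ := by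
  obtain ⟨hs0, hs1⟩ := one_sub_one_div_mem hu
  refine (abs_add_le _ _).trans (add_le_add (by rwa [abs_of_nonneg hs0]) ?_)
  refine abs_integral_exp_mul_le hθ fun r hr => ?_
  rw [← one_div_pow, abs_pow]
  exact pow_le_one₀ (abs_nonneg _) (abs_one_div_add_le hu hr)

theorem abs_limitGen_step_le {θ u n : ℝ} (hθ : 0 < θ) (hu : 1 ≤ u) (hn : 0 < n) :
    |(n + 1) * limitGen θ u - (n * limitGen θ (u + 1 / (θ * n)) + (1 - 1 / u))| ≤
      1 / θ ^ 2 * (1 / n) := by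
  set h := 1 / (θ * n) with hh
  have hh0 : 0 < h := by positivity
  have huh : 1 ≤ u + h := by linarith
  have hI := integrableOn_exp_mul_one_div hθ hu
  have hI' := integrableOn_exp_mul_one_div hθ huh
  have hJ := integrableOn_exp_mul_one_div_sq hθ hu
  have e : (n + 1) * limitGen θ u - (n * limitGen θ (u + h) + (1 - 1 / u)) =
      ∫ r in Set.Ioi (0 : ℝ), Real.exp (-θ * r) *
        (1 / (u + r) ^ 2 - 1 / h * (1 / (u + r) - 1 / (u + h + r))) := by
    have e1 : ∀ r : ℝ, Real.exp (-θ * r) *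
        (1 / (u + r) ^ 2 - 1 / h * (1 / (u + r) - 1 / (u + h + r))) =
        Real.exp (-θ * r) * (1 / (u + r) ^ 2) - 1 / h * (Real.exp (-θ * r) * (1 / (u + r)) -
          Real.exp (-θ * r) * (1 / (u + h + r))) := fun r => by ring
    simp only [e1]
    have hII : IntegrableOn (fun r => 1 / h * (Real.exp (-θ * r) * (1 / (u + r)) -
        Real.exp (-θ * r) * (1 / (u + h + r)))) (Set.Ioi 0) := (hI.sub hI').const_mul _
    rw [integral_sub hJ hII, integral_const_mul, integral_sub hI hI']
    have hu1 := mul_integral_exp_mul_one_div hθ hu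
    have hu2 := mul_integral_exp_mul_one_div hθ huh
    have e2 : 1 / h = n * θ := by
      rw [hh]
      field_simp
    rw [e2, mul_sub, mul_assoc, mul_assoc, hu1, hu2]
    simp only [limitGen, laplaceSq]
    ring
  rw [e]
  have e3 : 1 / θ ^ 2 * (1 / n) = h / θ := by
    rw [hh]
    field_simp
  rw [e3]
  refine abs_integral_exp_mul_le hθ fun r hr => ?_
  have e4 : 1 / (u + r) ^ 2 - 1 / h * (1 / (u + r) - 1 / (u + h + r)) =
      h * ((1 / (u + r)) ^ 2 * (1 / (u + h + r))) := by
    have : u + r ≠ 0 := by positivity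
    have : u + h + r ≠ 0 := by positivity
    field_simp
    ring
  rw [e4, abs_mul, abs_of_pos hh0, abs_mul, abs_pow]
  refine mul_le_of_le_one_right hh0.le ?_
  exact mul_le_one₀ (pow_le_one₀ (abs_nonneg _) (abs_one_div_add_le hu hr)) (abs_nonneg _)
    (abs_one_div_add_le huh hr)

theorem tendsto_chainExp_genFun {a l : ℝ} (ha : 0 < a) (hl : 0 < l) {u : ℝ} (hu : 1 ≤ u) :
    Tendsto (fun t : ℕ => chainExp a l l t (fun x => (x.map (genFun u)).sum) / (t + 1)) atTop
      (𝓝 (a / (2 * l + a) * limitGen (a / l) u)) := by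
  set ρ := a / (2 * l + a) with hρ
  set θ := a / l with hθ
  have hθ0 : 0 < θ := by positivity
  have hρ0 : 0 < ρ := by positivity
  set err : ℕ → ℝ := fun t => (l * (1 + 1 / a) + a) * chainExp a l l t (rateError a l t) +
    2 * (l / a) ^ 2 * (1 / (t + 1)) + ρ * (1 / θ ^ 2 * (1 / (t + 1))) with herr
  have herr0 : Tendsto err atTop (𝓝 0) := by
    have h1 := tendsto_one_div_add_atTop_nhds_zero_nat (𝕜 := ℝ)
    have h2 := (((tendsto_chainExp_rateError ha hl).const_mul (l * (1 + 1 / a) + a)).add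
      (h1.const_mul (2 * (l / a) ^ 2))).add ((h1.const_mul (1 / θ ^ 2)).const_mul ρ)
    simp only [mul_zero, add_zero] at h2
    exact h2
  have hB : ∀ t : ℕ, ∀ u : ℝ, 1 ≤ u →
      |chainExp a l l t (fun x => (x.map (genFun u)).sum) - (t + 1) * (ρ * limitGen θ u)| ≤
        1 + ρ * (1 + 1 / θ) + ∑ s ∈ Finset.range t, err s := by
    intro t
    induction t with
    | zero =>
      intro u hu
      obtain ⟨hs0, hs1⟩ := one_sub_one_div_mem hu
      have h1 : chainExp a l l 0 (fun x => (x.map (genFun u)).sum) = 1 - 1 / u := by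
        simp [chainExp_zero, genFun]
      rw [h1, Nat.cast_zero, zero_add, one_mul, Finset.range_zero, Finset.sum_empty, add_zero]
      refine (abs_sub _ _).trans (add_le_add (by rwa [abs_of_nonneg hs0]) ?_)
      rw [abs_mul, abs_of_pos hρ0]
      exact mul_le_mul_of_nonneg_left (abs_limitGen_le hθ0 hu) hρ0.le
    | succ t ih =>
      intro u hu
      have ht : (0 : ℝ) < t + 1 := by positivity
      have hh : l / (a * ((t : ℝ) + 1)) = 1 / (θ * (t + 1)) := by
        rw [hθ]
        field_simp
      have hh0 : 0 < 1 / (θ * ((t : ℝ) + 1)) := by positivity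
      have h1 := abs_chainExp_genFun_succ_sub_le ha hl hu t
      have h2 := mul_le_mul_of_nonneg_left (abs_limitGen_step_le hθ0 hu ht) hρ0.le
      have h3 := ih (u + 1 / (θ * (t + 1))) (by linarith)
      rw [hh] at h1
      rw [← abs_of_pos hρ0, ← abs_mul, abs_of_pos hρ0] at h2
      rw [Finset.sum_range_succ]
      push_cast
      rw [abs_le] at h1 h2 h3 ⊢
      simp only [herr] at h3 ⊢
      constructor <;> linarith [h1.1, h1.2, h2.1, h2.2, h3.1, h3.2]
  rw [tendsto_iff_dist_tendsto_zero]
  have hlim := ((tendsto_one_div_add_atTop_nhds_zero_nat (𝕜 := ℝ)).const_mul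
    (1 + ρ * (1 + 1 / θ))).add herr0.cesaro
  rw [mul_zero, add_zero] at hlim
  refine squeeze_zero (fun _ => dist_nonneg) (fun t => ?_) hlim
  have ht : (0 : ℝ) < t + 1 := by positivity
  have e : chainExp a l l t (fun x => (x.map (genFun u)).sum) / (t + 1) - ρ * limitGen θ u =
      (chainExp a l l t (fun x => (x.map (genFun u)).sum) - (t + 1) * (ρ * limitGen θ u)) /
        (t + 1) := by
    field_simp
  rw [Real.dist_eq, e, abs_div, abs_of_pos ht]
  refine (div_le_div_of_nonneg_right (hB t u hu) ht.le).trans ?_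
  rw [add_div, mul_one_div]
  refine add_le_add_right ?_ _
  have herr1 : ∀ s, 0 ≤ err s := fun s => by
    have : 0 ≤ chainExp a l l s (rateError a l s) :=
      chainExp_nonneg ha hl fun x _ => add_nonneg (abs_nonneg _) (abs_nonneg _)
    positivity
  have hs := Finset.sum_nonneg fun s (_ : s ∈ Finset.range t) => herr1 s
  rcases t.eq_zero_or_pos with h0 | h0
  · simp [h0]
  · have ht' : (0 : ℝ) < t := by exact_mod_cast h0
    rw [← div_eq_inv_mul]
    exact div_le_div_of_nonneg_left hs ht' (by linarith)

theorem summable_mul_pow_of_abs_le {c : ℕ → ℝ} {C : ℝ} (hc : ∀ j, |c j| ≤ C) {s : ℝ}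
    (hs : s ∈ Set.Ioo (0 : ℝ) 1) : Summable fun j => c j * s ^ j := by
  refine Summable.of_norm_bounded ((summable_geometric_of_lt_one hs.1.le hs.2).mul_left C)
    fun j => ?_
  rw [Real.norm_eq_abs, abs_mul, abs_of_pos (pow_pos hs.1 j)]
  exact mul_le_mul_of_nonneg_right (hc j) (pow_pos hs.1 j).le

theorem abs_tsum_mul_pow_le {c : ℕ → ℝ} {C : ℝ} (hc : ∀ j, |c j| ≤ C) {s : ℝ}
    (hs : s ∈ Set.Ioo (0 : ℝ) 1) : |∑' j, c j * s ^ j| ≤ C / (1 - s) := by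
  rw [← Real.norm_eq_abs, div_eq_mul_inv]
  refine tsum_of_norm_bounded ((hasSum_geometric_of_lt_one hs.1.le hs.2).mul_left C) fun j => ?_
  rw [Real.norm_eq_abs, abs_mul, abs_of_pos (pow_pos hs.1 j)]
  exact mul_le_mul_of_nonneg_right (hc j) (pow_pos hs.1 j).le

theorem tsum_mul_pow_eq_zero_add {c : ℕ → ℝ} {C : ℝ} (hc : ∀ j, |c j| ≤ C) {s : ℝ}
    (hs : s ∈ Set.Ioo (0 : ℝ) 1) :
    ∑' j, c j * s ^ j = c 0 + s * ∑' j, c (j + 1) * s ^ j := by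
  rw [(summable_mul_pow_of_abs_le hc hs).tsum_eq_zero_add, pow_zero, mul_one, ← tsum_mul_left]
  congr 2
  funext j
  ring

theorem tendsto_zeroth_coeff_zero {A : ℕ → ℕ → ℝ} {C : ℝ} (hA : ∀ t j, |A t j| ≤ C)
    (h : ∀ s ∈ Set.Ioo (0 : ℝ) 1, Tendsto (fun t => ∑' j, A t j * s ^ j) atTop (𝓝 0)) :
    Tendsto (fun t => A t 0) atTop (𝓝 0) := by
  have hC : 0 ≤ C := (abs_nonneg _).trans (hA 0 0)
  rw [Metric.tendsto_atTop]
  intro ε hε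
  set s := min (1 / 2) (ε / (4 * (C + 1))) with hs
  have hs0 : 0 < s := by positivity
  have hs1 : s ≤ 1 / 2 := min_le_left _ _
  have hs2 : s * (4 * (C + 1)) ≤ ε := (le_div_iff₀ (by positivity)).1 (min_le_right _ _)
  have hsm : s ∈ Set.Ioo (0 : ℝ) 1 := ⟨hs0, by linarith⟩
  obtain ⟨T, hT⟩ := Metric.tendsto_atTop.1 (h s hsm) (ε / 2) (by positivity)
  refine ⟨T, fun t ht => ?_⟩
  have h1 := hT t ht
  rw [Real.dist_eq, sub_zero, tsum_mul_pow_eq_zero_add (hA t) hsm] at h1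
  have h2 := abs_tsum_mul_pow_le (fun j => hA t (j + 1)) hsm
  have h3 : C / (1 - s) ≤ 2 * C := by
    rw [div_le_iff₀ (by linarith)]
    nlinarith
  have h4 : |s * ∑' j, A t (j + 1) * s ^ j| ≤ s * (2 * C) := by
    rw [abs_mul, abs_of_pos hs0]
    exact mul_le_mul_of_nonneg_left (h2.trans h3) hs0.le
  rw [Real.dist_eq, sub_zero]
  rw [abs_lt] at h1 ⊢
  rw [abs_le] at h4
  constructor <;> nlinarith

theorem tendsto_coeff_zero {A : ℕ → ℕ → ℝ} {C : ℝ} (hA : ∀ t j, |A t j| ≤ C)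
    (h : ∀ s ∈ Set.Ioo (0 : ℝ) 1, Tendsto (fun t => ∑' j, A t j * s ^ j) atTop (𝓝 0)) (j : ℕ) :
    Tendsto (fun t => A t j) atTop (𝓝 0) := by
  induction j generalizing A with
  | zero => exact tendsto_zeroth_coeff_zero hA h
  | succ j ih =>
    have h0 := tendsto_zeroth_coeff_zero hA h
    have hshift : ∀ s ∈ Set.Ioo (0 : ℝ) 1,
        Tendsto (fun t => ∑' j, A t (j + 1) * s ^ j) atTop (𝓝 0) := fun s hs => by
      have h1 := ((h s hs).sub h0).const_mul s⁻¹
      rw [sub_zero, mul_zero] at h1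
      refine h1.congr fun t => ?_
      rw [tsum_mul_pow_eq_zero_add (hA t) hs, add_sub_cancel_left,
        inv_mul_cancel_left₀ hs.1.ne']
    exact ih (A := fun t j => A t (j + 1)) (fun t j => hA t (j + 1)) hshift

theorem tendsto_coeff {A : ℕ → ℕ → ℝ} {b : ℕ → ℝ} {C : ℝ} (hA : ∀ t j, |A t j| ≤ C)
    (hb : ∀ j, |b j| ≤ C)
    (h : ∀ s ∈ Set.Ioo (0 : ℝ) 1,
      Tendsto (fun t => ∑' j, A t j * s ^ j) atTop (𝓝 (∑' j, b j * s ^ j))) (j : ℕ) :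
    Tendsto (fun t => A t j) atTop (𝓝 (b j)) := by
  rw [← tendsto_sub_nhds_zero_iff]
  refine tendsto_coeff_zero (A := fun t j => A t j - b j) (C := C + C)
    (fun t j => (abs_sub _ _).trans (add_le_add (hA t j) (hb j))) (fun s hs => ?_) j
  refine (tendsto_sub_nhds_zero_iff.2 (h s hs)).congr fun t => ?_
  rw [← (summable_mul_pow_of_abs_le (hA t) hs).tsum_sub (summable_mul_pow_of_abs_le hb hs)]
  simp only [sub_mul]

/-- The limiting in-degree distribution of the critical chain. -/
noncomputable def limitProb (θ : ℝ) : ℕ → ℝ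
  | 0 => laplaceSq θ 1
  | j + 1 => θ * ∫ r in Set.Ioi (0 : ℝ), Real.exp (-θ * r) * (r ^ j / (1 + r) ^ (j + 2))

theorem hypU_one (θ : ℝ) : hypU 1 0 θ = limitProb θ 0 := by
  rw [hypU, Real.Gamma_one, inv_one, one_mul, limitProb, laplaceSq]
  refine setIntegral_congr_fun measurableSet_Ioi fun r hr => ?_
  have hr' : 0 < r := hr
  have h1 : (1 + r) ^ ((0 : ℝ) - 1 - 1) = 1 / (1 + r) ^ 2 := by
    rw [show (0 : ℝ) - 1 - 1 = -(2 : ℕ) by norm_num, Real.rpow_neg (by positivity),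
      Real.rpow_natCast, one_div]
  simp only [h1, sub_self, Real.rpow_zero, mul_one]

theorem mul_Gamma_mul_hypU (θ : ℝ) (j : ℕ) :
    θ * Real.Gamma (j + 1 : ℕ) * hypU (j + 1 : ℕ) 0 θ = limitProb θ (j + 1) := by
  have hG : Real.Gamma (j + 1 : ℕ) ≠ 0 := (Real.Gamma_pos_of_pos (by positivity)).ne'
  rw [hypU, mul_assoc, mul_inv_cancel_left₀ hG, limitProb]
  congr 1
  refine setIntegral_congr_fun measurableSet_Ioi fun r hr => ?_
  have hr' : 0 < r := hr
  have h1 : (1 + r) ^ ((0 : ℝ) - (j + 1 : ℕ) - 1) = ((1 + r) ^ (j + 2))⁻¹ := by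
    rw [show (0 : ℝ) - (j + 1 : ℕ) - 1 = -(j + 2 : ℕ) by push_cast; ring,
      Real.rpow_neg (by positivity), Real.rpow_natCast]
  have h2 : r ^ (((j + 1 : ℕ) : ℝ) - 1) = r ^ j := by
    rw [Nat.cast_add, Nat.cast_one, add_sub_cancel_right, Real.rpow_natCast]
  simp only [h1, h2, mul_assoc, div_eq_mul_inv]

theorem abs_pow_div_pow_le {r : ℝ} (hr : 0 < r) (j : ℕ) : |r ^ j / (1 + r) ^ (j + 2)| ≤ 1 := by
  rw [abs_of_nonneg (by positivity), div_le_one (by positivity)]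
  calc r ^ j ≤ (1 + r) ^ j := by gcongr; linarith
    _ ≤ (1 + r) ^ (j + 2) := pow_le_pow_right₀ (by linarith) (by omega)

theorem abs_limitProb_le {θ : ℝ} (hθ : 0 < θ) (j : ℕ) : |limitProb θ j| ≤ 1 + 1 / θ := by
  have hθ' : 0 < 1 / θ := by positivity
  cases j with
  | zero =>
    refine (abs_integral_exp_mul_le hθ (c := 1) fun r hr => ?_).trans (by linarith)
    rw [← one_div_pow, abs_pow]
    exact pow_le_one₀ (abs_nonneg _) (abs_one_div_add_le le_rfl hr)
  | succ j =>
    rw [limitProb, abs_mul, abs_of_pos hθ]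
    have h := mul_le_mul_of_nonneg_left
      (abs_integral_exp_mul_le hθ fun r hr => abs_pow_div_pow_le hr j) hθ.le
    rw [mul_one_div_cancel hθ.ne'] at h
    linarith

theorem tsum_limitProb_mul_pow {θ u : ℝ} (hθ : 0 < θ) (hu : 1 < u) :
    ∑' j, limitProb θ j * (1 - 1 / u) ^ j = limitGen θ u := by
  have hs1 : 1 - 1 / u < 1 := by
    have : 0 < 1 / u := by positivity
    linarith
  have hs0 : 0 < 1 - 1 / u := by
    have : 1 / u < 1 := (div_lt_one (by linarith)).2 hu
    linarith
  set s := 1 - 1 / u with hs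
  set F : ℕ → ℝ → ℝ := fun j r => Real.exp (-θ * r) * (s ^ j * (r ^ j / (1 + r) ^ (j + 2))) with hF
  have hcont : ∀ j : ℕ, ContinuousOn (fun r : ℝ => s ^ j * (r ^ j / (1 + r) ^ (j + 2)))
      (Set.Ioi 0) := fun j => by
    refine continuousOn_const.mul (ContinuousOn.div (by fun_prop) (by fun_prop) fun r hr => ?_)
    have : 0 < r := hr
    positivity
  have hbd : ∀ (j : ℕ) (r : ℝ), 0 < r → |s ^ j * (r ^ j / (1 + r) ^ (j + 2))| ≤ s ^ j :=
    fun j r hr => by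
      rw [abs_mul, abs_of_pos (pow_pos hs0 j)]
      exact mul_le_of_le_one_right (pow_pos hs0 j).le (abs_pow_div_pow_le hr j)
  have hFint : ∀ j, IntegrableOn (F j) (Set.Ioi 0) := fun j =>
    integrableOn_exp_mul hθ (hcont j) (hbd j)
  have hsum : Summable fun j => ∫ r in Set.Ioi (0 : ℝ), ‖F j r‖ := by
    refine Summable.of_nonneg_of_le (fun j => integral_nonneg fun r => norm_nonneg _) (fun j => ?_)
      ((summable_geometric_of_lt_one hs0.le hs1).mul_right (1 / θ))
    have h1 : ∀ r, ‖F j r‖ = Real.exp (-θ * r) * |s ^ j * (r ^ j / (1 + r) ^ (j + 2))| :=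
      fun r => by rw [hF, Real.norm_eq_abs, abs_mul, Real.abs_exp]
    simp only [h1]
    refine (le_abs_self _).trans ((abs_integral_exp_mul_le hθ (c := s ^ j)
      fun r hr => ?_).trans_eq (by ring))
    rw [abs_abs]
    exact hbd j r hr
  have hmain := (hasSum_integral_of_summable_integral_norm hFint hsum).tsum_eq
  have hpt : ∫ r in Set.Ioi (0 : ℝ), ∑' j, F j r =
      ∫ r in Set.Ioi (0 : ℝ), 1 / s * (Real.exp (-θ * r) * (1 / (1 + r)) -
        Real.exp (-θ * r) * (1 / (u + r))) := by
    refine setIntegral_congr_fun measurableSet_Ioi fun r hr => ?_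
    have hr' : 0 < r := hr
    have h1r : 0 < 1 + r := by linarith
    have hq0 : 0 ≤ s * (r / (1 + r)) := by positivity
    have hq1 : s * (r / (1 + r)) < 1 := by
      have : r / (1 + r) ≤ 1 := (div_le_one h1r).2 (by linarith)
      nlinarith
    have h1 : ∀ j, F j r = Real.exp (-θ * r) * (1 / (1 + r) ^ 2) * (s * (r / (1 + r))) ^ j :=
      fun j => by
        simp only [hF, mul_pow, div_pow, pow_add]
        field_simp
    simp only [h1]
    rw [tsum_mul_left, tsum_geometric_of_lt_one hq0 hq1]
    have hur : 0 < u + r := by linarith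
    have h2 : 1 - s * (r / (1 + r)) = (u + r) / (u * (1 + r)) := by
      rw [hs]
      field_simp
      ring
    have h3 : 1 / (1 + r) - 1 / (u + r) = s * u / ((1 + r) * (u + r)) := by
      rw [hs]
      field_simp
      ring
    rw [h2, ← mul_sub, h3]
    field_simp
  have hI1 := integrableOn_exp_mul_one_div hθ (le_refl (1 : ℝ))
  have hI2 := integrableOn_exp_mul_one_div hθ hu.le
  rw [hpt, integral_const_mul, integral_sub hI1 hI2] at hmain
  have hj : ∀ j, ∫ r in Set.Ioi (0 : ℝ), F j r = θ⁻¹ * (limitProb θ (j + 1) * s ^ j) := fun j => by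
    have h1 : ∀ r, F j r = s ^ j * (Real.exp (-θ * r) * (r ^ j / (1 + r) ^ (j + 2))) := fun r => by
      simp only [hF]
      ring
    simp only [h1]
    rw [integral_const_mul, limitProb, mul_assoc θ, inv_mul_cancel_left₀ hθ.ne', mul_comm]
  simp only [hj] at hmain
  rw [tsum_mul_left] at hmain
  have hu1 := mul_integral_exp_mul_one_div hθ (le_refl (1 : ℝ))
  have hu2 := mul_integral_exp_mul_one_div hθ hu.le
  rw [tsum_mul_pow_eq_zero_add (abs_limitProb_le hθ) ⟨hs0, hs1⟩]
  have h4 : s * ∑' j, limitProb θ (j + 1) * s ^ j =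
      θ * (∫ r in Set.Ioi (0 : ℝ), Real.exp (-θ * r) * (1 / (1 + r))) -
      θ * ∫ r in Set.Ioi (0 : ℝ), Real.exp (-θ * r) * (1 / (u + r)) := by
    rw [← mul_sub, ← mul_left_cancel_iff_of_pos (show 0 < s⁻¹ * θ⁻¹ by positivity)]
    calc _ = θ⁻¹ * ∑' j, limitProb θ (j + 1) * s ^ j := by field_simp
      _ = _ := by
        rw [hmain]
        field_simp
  rw [h4, hu1, hu2, limitProb, limitGen]
  ring

theorem sum_map_eq_sum_count (f : ℕ → ℝ) (m : ℕ) (x : List ℕ) (hx : ∀ k ∈ x, k < m) :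
    (x.map f).sum = ∑ j ∈ Finset.range m, (x.count j : ℝ) * f j := by
  induction x with
  | nil => simp
  | cons b x ih =>
    have hb : b ∈ Finset.range m := Finset.mem_range.2 (hx b (by simp))
    rw [List.map_cons, List.sum_cons, ih fun k hk => hx k (by simp [hk])]
    have h : ∀ j, (((b :: x).count j : ℕ) : ℝ) * f j =
        (x.count j : ℝ) * f j + if b = j then f j else 0 := fun j => by
      rw [List.count_cons]
      by_cases hbj : b = j <;> simp [hbj, add_mul]
    simp only [h, Finset.sum_add_distrib, Finset.sum_ite_eq, if_pos hb]
    ring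

theorem Reachable.lt_of_mem {t : ℕ} {x : List ℕ} (hx : Reachable t x) {k : ℕ} (hk : k ∈ x) :
    k < t + 2 := by
  have := List.single_le_sum (l := x) (fun _ _ => Nat.zero_le _) k hk
  have := hx.2.2
  omega

theorem tsum_chainExp_count {a l : ℝ} (ha : 0 < a) (hl : 0 < l) (t : ℕ) (u : ℝ) :
    ∑' j, chainExp a l l t (fun x => (x.count j : ℝ)) / (t + 1) * (1 - 1 / u) ^ j =
      chainExp a l l t (fun x => (x.map (genFun u)).sum) / (t + 1) := by
  rw [tsum_eq_sum (s := Finset.range (t + 2)) fun j hj => ?_]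
  · have h : chainExp a l l t (fun x => (x.map (genFun u)).sum) =
        chainExp a l l t (∑ j ∈ Finset.range (t + 2),
          fun x => (1 - 1 / u) ^ j * (x.count j : ℝ)) := by
      refine chainExp_congr ha.le hl.le hl.le fun x hx => ?_
      rw [sum_map_eq_sum_count _ (t + 2) x fun k hk => hx.lt_of_mem hk, Finset.sum_apply]
      exact Finset.sum_congr rfl fun j _ => mul_comm _ _
    rw [h, map_sum, Finset.sum_div]
    refine Finset.sum_congr rfl fun j _ => ?_
    rw [chainExp_const_mul]
    ring
  · have h : chainExp a l l t (fun x => (x.count j : ℝ)) = chainExp a l l t fun _ => 0 := by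
      refine chainExp_congr ha.le hl.le hl.le fun x hx => ?_
      rw [List.count_eq_zero.2 fun hm => ?_, Nat.cast_zero]
      exact hj (Finset.mem_range.2 (hx.lt_of_mem hm))
    rw [h, chainExp_const ha hl, zero_div, zero_mul]

theorem tendsto_chainExp_count {a l : ℝ} (ha : 0 < a) (hl : 0 < l) (j : ℕ) :
    Tendsto (fun t : ℕ => chainExp a l l t (fun x => (x.count j : ℝ)) / (t + 1)) atTop
      (𝓝 (a / (2 * l + a) * limitProb (a / l) j)) := by
  have hρ0 : 0 < a / (2 * l + a) := by positivity
  have hθ0 : 0 < a / l := by positivity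
  have hθ1 : 0 < 1 / (a / l) := by positivity
  have hC : 0 ≤ a / (2 * l + a) * (1 + 1 / (a / l)) := by positivity
  refine tendsto_coeff (A := fun t j => chainExp a l l t (fun x => (x.count j : ℝ)) / (t + 1))
    (b := fun j => a / (2 * l + a) * limitProb (a / l) j)
    (C := 1 + a / (2 * l + a) * (1 + 1 / (a / l))) (fun t j => ?_) (fun j => ?_)
    (fun s hs => ?_) j
  · have h0 : 0 ≤ chainExp a l l t (fun x => (x.count j : ℝ)) :=
      chainExp_nonneg ha hl fun x _ => Nat.cast_nonneg _
    have h1 : chainExp a l l t (fun x => (x.count j : ℝ)) ≤ t + 1 := by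
      refine le_of_le_of_eq (chainExp_mono (G := fun _ => (t : ℝ) + 1) ha.le hl.le hl.le
        fun x hx => ?_) (chainExp_const ha hl t _)
      exact_mod_cast List.count_le_length.trans hx.2.1
    rw [abs_of_nonneg (by positivity)]
    have : chainExp a l l t (fun x => (x.count j : ℝ)) / (t + 1) ≤ 1 :=
      (div_le_one (by positivity)).2 h1
    linarith
  · rw [abs_mul, abs_of_pos hρ0]
    have := mul_le_mul_of_nonneg_left (abs_limitProb_le hθ0 j) hρ0.le
    linarith
  · obtain ⟨hs0, hs1⟩ := hs
    have hu : 1 < 1 / (1 - s) := by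
      rw [lt_div_iff₀ (by linarith)]
      linarith
    have hsu : s = 1 - 1 / (1 / (1 - s)) := by
      rw [one_div_one_div]
      ring
    rw [hsu]
    simp only [mul_assoc]
    rw [tsum_mul_left, tsum_limitProb_mul_pow hθ0 hu]
    simp only [tsum_chainExp_count ha hl]
    exact tendsto_chainExp_genFun ha hl hu.le

theorem tendsto_inDegProb {a l : ℝ} (ha : 0 < a) (hl : 0 < l) (j : ℕ) :
    Tendsto (fun t => inDegProb a l l t j) atTop (𝓝 (limitProb (a / l) j)) := by
  set ρ := a / (2 * l + a) with hρ
  have hρ0 : 0 < ρ := by positivity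
  have h1 := (tendsto_chainExp_count ha hl j).const_mul (1 / ρ)
  rw [← hρ, ← mul_assoc, one_div_mul_cancel hρ0.ne', one_mul] at h1
  have h2 := (tendsto_chainExp_abs_length ha hl).const_mul (1 / ρ)
  rw [mul_zero] at h2
  have h3 : Tendsto (fun t => inDegProb a l l t j -
      1 / ρ * (chainExp a l l t (fun x => (x.count j : ℝ)) / (t + 1))) atTop (𝓝 0) := by
    refine squeeze_zero_norm (fun t => ?_) h2
    have ht : (0 : ℝ) < t + 1 := by positivity
    have e : inDegProb a l l t j -
        1 / ρ * (chainExp a l l t (fun x => (x.count j : ℝ)) / (t + 1)) =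
        chainExp a l l t (fun x => (x.count j : ℝ) / x.length -
          1 / (ρ * (t + 1)) * (x.count j : ℝ)) := by
      rw [inDegProb, tsum_chainDist_mul, chainExp_sub, chainExp_const_mul]
      field_simp
    rw [e, Real.norm_eq_abs, ← chainExp_const_mul]
    refine (abs_chainExp_le ha hl t _).trans (chainExp_mono ha.le hl.le hl.le fun x hx => ?_)
    have hN := hx.one_le_length
    have hN0 : 0 < (x.length : ℝ) := by linarith
    have e2 : (x.count j : ℝ) / x.length - 1 / (ρ * (t + 1)) * (x.count j : ℝ) =
        -((x.count j : ℝ) / x.length) * (1 / ρ * (x.length / ((t : ℝ) + 1) - ρ)) := by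
      field_simp
      ring
    have h4 : (x.count j : ℝ) / x.length ≤ 1 := by
      rw [div_le_one hN0]
      exact_mod_cast List.count_le_length
    rw [e2, abs_mul, abs_neg, abs_of_nonneg (by positivity), abs_mul,
      abs_of_pos (by positivity : 0 < 1 / ρ)]
    exact mul_le_of_le_one_left (by positivity) h4
  simpa using h3.add h1

/-- Critical regime: if `μ₂ > 0` and `λ₂ = μ₂` then for every `j` the limit
`p_j = lim_t P(d(V_t) = j)` exists, with `p_0 = U(1, 0, λ₁/λ₂)` and
`p_j = (λ₁/λ₂) Γ(j) U(j, 0, λ₁/λ₂)` for `j ≥ 1`. -/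
theorem limit_in_degree_distribution_critical
    (lam1 lam2 mu2 : ℝ) (hlam1 : 0 < lam1) (hmu2 : 0 < mu2) (h : lam2 = mu2) :
    Tendsto (fun t => inDegProb lam1 lam2 mu2 t 0) atTop (𝓝 (hypU 1 0 (lam1 / lam2))) ∧
    ∀ j : ℕ, 1 ≤ j →
      Tendsto (fun t => inDegProb lam1 lam2 mu2 t j) atTop
        (𝓝 (lam1 / lam2 * Real.Gamma j * hypU j 0 (lam1 / lam2))) := by
  subst h
  refine ⟨?_, fun j hj => ?_⟩
  · rw [hypU_one]
    exact tendsto_inDegProb hlam1 hmu2 0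
  · obtain ⟨j, rfl⟩ := Nat.exists_eq_succ_of_ne_zero (Nat.one_le_iff_ne_zero.1 hj)
    rw [Nat.succ_eq_add_one, mul_Gamma_mul_hypU]
    exact tendsto_inDegProb hlam1 hmu2 (j + 1)
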